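/- arXiv:2603.14746 — 2 statements merged into one kernel-verified Lean document; each statement's English description precedes it below -/
import Mathlib

section
/- Let G = (I, J, {A_i}, {B_j}, μ, V) be a non-degenerate projection game, and suppose c(a,b|i,j) = ⟨ψ, (P^i_a ⊗ Q^j_b) ψ⟩ is a quantum correlation for G (POVMs of positive semidefinite matrices on finite-dimensional Hilbert spaces, ψ a unit vector in their tensor product) with w_G(c) ≥ 1 − ε. Let L = max_{(i,j) : μ(i,j)>0} μ(i)/μ(i,j), where μ(i) = Σ_j μ(i,j). Then there exists a finite-dimensional tracial correlation c′ for G — i.e. n ≥ 1, PVMs {r^i_a}_{a∈A_i} and {r^j_b}_{b∈B_j} of orthogonal projections in M_n(ℂ), and a positive semidefinite σ ∈ M_n(ℂ) with Tr(σ) = 1 and Tr(σ x y) = Tr(σ y x) for all x, y in the unital *-subalgebra generated by all these projections, with c′(a,b|i,j) = Tr(σ r^i_a r^j_b) — such that w_G(c′) ≥ 1 − 148(Lε)^{1/4}. -/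
open scoped ComplexOrder Kronecker Matrix

namespace Matrix

section FrobeniusSquare

variable {ι κ : Type*} [Fintype ι] [Fintype κ]

/-- The square of the Frobenius norm of a complex matrix. -/
noncomputable def frobSq (M : Matrix ι κ ℂ) : ℝ := ∑ k, ∑ l, Complex.normSq (M k l)

lemma frobSq_eq_trace (M : Matrix ι κ ℂ) : M.frobSq = (Mᴴ * M).trace.re := by
  simp only [frobSq, Matrix.trace, Matrix.diag, Matrix.mul_apply, Matrix.conjTranspose_apply,
    Complex.re_sum]
  rw [Finset.sum_comm]
  refine Finset.sum_congr rfl fun l _ => Finset.sum_congr rfl fun k _ => ?_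
  simp [Complex.normSq_apply]

lemma frobSq_mul_of_mul_conjTranspose [DecidableEq κ] (M : Matrix ι κ ℂ) {V : Matrix κ κ ℂ}
    (hV : V * Vᴴ = 1) : (M * V).frobSq = M.frobSq := by
  rw [frobSq_eq_trace, frobSq_eq_trace, conjTranspose_mul, Matrix.mul_assoc, Matrix.trace_mul_comm,
    ← Matrix.mul_assoc, Matrix.mul_assoc, Matrix.mul_assoc, hV, Matrix.mul_one]

lemma frobSq_conjTranspose (M : Matrix ι κ ℂ) : Mᴴ.frobSq = M.frobSq := by
  simp only [frobSq, conjTranspose_apply]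
  rw [Finset.sum_comm]
  simp [Complex.normSq_conj]

lemma frobSq_conj [DecidableEq κ] (M : Matrix κ κ ℂ) {V : Matrix κ κ ℂ}
    (hV : V * Vᴴ = 1) : (Vᴴ * M * V).frobSq = M.frobSq := by
  rw [frobSq_mul_of_mul_conjTranspose _ hV, ← frobSq_conjTranspose, conjTranspose_mul,
    conjTranspose_conjTranspose, frobSq_mul_of_mul_conjTranspose _ hV, frobSq_conjTranspose]

lemma frobSq_diagonal [DecidableEq κ] (d : κ → ℂ) :
    (diagonal d).frobSq = ∑ k, Complex.normSq (d k) := by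
  refine Finset.sum_congr rfl fun k _ => ?_
  rw [Finset.sum_eq_single k] <;> simp +contextual [diagonal_apply_ne']

lemma frobSq_mul_of_conjTranspose_mul [DecidableEq ι] (M : Matrix ι κ ℂ) {μ : Type*} [Fintype μ]
    {B : Matrix μ ι ℂ} (hB : Bᴴ * B = 1) : (B * M).frobSq = M.frobSq := by
  rw [frobSq_eq_trace, frobSq_eq_trace, conjTranspose_mul, Matrix.mul_assoc, ← Matrix.mul_assoc Bᴴ,
    hB, Matrix.one_mul]

lemma PosSemidef.exists_diagonalization [DecidableEq ι] {P : Matrix ι ι ℂ} (hP : P.PosSemidef) :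
    ∃ (V : Matrix ι ι ℂ) (d : ι → ℝ), Vᴴ * V = 1 ∧ V * Vᴴ = 1 ∧ (∀ k, 0 ≤ d k) ∧
      P = V * diagonal (fun k => (d k : ℂ)) * Vᴴ := by
  refine ⟨hP.1.eigenvectorUnitary, hP.1.eigenvalues, ?_, ?_, hP.eigenvalues_nonneg, ?_⟩
  · exact Unitary.coe_star_mul_self _
  · exact Unitary.coe_mul_star_self _
  · conv_lhs => rw [hP.1.spectral_theorem, Unitary.conjStarAlgAut_apply]
    rfl

/-- A square complex matrix is close to a unitary when its Gram matrix is close to the identity. -/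
lemma exists_unitary_frobSq_sub_le [DecidableEq ι] [DecidableEq κ]
    (hcard : Fintype.card ι = Fintype.card κ) (X : Matrix ι κ ℂ) :
    ∃ W : Matrix ι κ ℂ, Wᴴ * W = 1 ∧ W * Wᴴ = 1 ∧ (W - X).frobSq ≤ (Xᴴ * X - 1).frobSq := by
  obtain ⟨V, d, hV, hV', hd, hX⟩ := (posSemidef_conjTranspose_mul_self X).exists_diagonalization
  have hgram : (X * V)ᴴ * (X * V) = diagonal (fun k => (d k : ℂ)) := by
    calc (X * V)ᴴ * (X * V) = Vᴴ * (Xᴴ * X) * V := by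
          simp only [conjTranspose_mul, Matrix.mul_assoc]
      _ = (Vᴴ * V) * diagonal (fun k => (d k : ℂ)) * (Vᴴ * V) := by
          rw [hX]; simp only [Matrix.mul_assoc]
      _ = _ := by rw [hV]; simp
  let y : κ → EuclideanSpace ℂ ι := fun k => WithLp.toLp 2 fun u => (X * V) u k
  have hy (k l : κ) : inner ℂ (y k) (y l) = if k = l then (d k : ℂ) else 0 := by
    have := congrFun (congrFun hgram k) l
    rw [diagonal_apply] at this
    rw [← this, mul_apply, PiLp.inner_apply]
    refine Finset.sum_congr rfl fun u _ => ?_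
    simp [y, conjTranspose_apply, mul_comm]
  have hnorm (k : κ) : ‖y k‖ ^ 2 = d k := by
    have := hy k k
    rw [inner_self_eq_norm_sq_to_K, if_pos rfl] at this
    exact Complex.ofReal_injective (by push_cast; exact this)
  let v : κ → EuclideanSpace ℂ ι := fun k => ((Real.sqrt (d k))⁻¹ : ℂ) • y k
  have hv : Orthonormal ℂ (({k | d k ≠ 0} : Set κ).domRestrict v) := by
    rw [orthonormal_iff_ite]
    rintro ⟨k, hk⟩ ⟨l, hl⟩
    simp only [Set.domRestrict_apply, v, inner_smul_left, inner_smul_right, hy, Subtype.mk.injEq]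
    by_cases hkl : k = l
    · subst hkl
      have : (Real.sqrt (d k) : ℂ) ≠ 0 := by
        simpa [Real.sqrt_eq_zero (hd k)] using hk
      have h2 : (d k : ℂ) = Real.sqrt (d k) * Real.sqrt (d k) := by
        exact_mod_cast (Real.mul_self_sqrt (hd k)).symm
      simp only [if_true, map_inv₀, Complex.conj_ofReal]
      rw [h2]
      field_simp
    · simp [hkl]
  obtain ⟨b, hb⟩ := hv.exists_orthonormalBasis_extension_of_card_eq
    (by rw [finrank_euclideanSpace, hcard])
  let B : Matrix ι κ ℂ := Matrix.of fun u k => b k u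
  have hB : Bᴴ * B = 1 := by
    ext k l
    have := orthonormal_iff_ite.mp b.orthonormal k l
    rw [one_apply, ← this, mul_apply, PiLp.inner_apply]
    exact Finset.sum_congr rfl fun u _ => by simp [B, mul_comm]
  have hXV : X * V = B * diagonal (fun k => (Real.sqrt (d k) : ℂ)) := by
    ext u k
    rw [mul_diagonal]
    by_cases hk : d k = 0
    · have h0 : y k = 0 := by
        have := hnorm k
        rw [hk] at this
        simpa using this
      have := congrArg (fun z : EuclideanSpace ℂ ι => z u) h0
      simpa [y, hk] using this
    · have hs : (Real.sqrt (d k) : ℂ) ≠ 0 := by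
        simpa [Real.sqrt_eq_zero (hd k)] using hk
      have := hb k hk
      simp only [B, of_apply, this, v, PiLp.smul_apply, smul_eq_mul, y]
      field_simp
  have hBV : (B * Vᴴ) * (B * Vᴴ)ᴴ = B * Bᴴ := by
    rw [conjTranspose_mul, conjTranspose_conjTranspose, Matrix.mul_assoc, ← Matrix.mul_assoc Vᴴ,
      hV, Matrix.one_mul]
  refine ⟨B * Vᴴ, ?_, ?_, ?_⟩
  · rw [conjTranspose_mul, conjTranspose_conjTranspose, Matrix.mul_assoc, ← Matrix.mul_assoc Bᴴ,
      hB, Matrix.one_mul, hV']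
  · rw [hBV]
    exact (mul_eq_one_comm_of_card_eq _ _ _ hcard.symm).mp hB
  · have h1 : (B * Vᴴ - X).frobSq
        = (diagonal (fun k => (1 - Real.sqrt (d k) : ℂ))).frobSq := by
      rw [← frobSq_mul_of_mul_conjTranspose _ hV', ← frobSq_mul_of_conjTranspose_mul _ hB,
        Matrix.sub_mul, hXV, Matrix.mul_assoc, hV, ← Matrix.mul_sub, ← diagonal_one,
        diagonal_sub]
    have h2 : (Xᴴ * X - 1).frobSq = (diagonal (fun k => (d k - 1 : ℂ))).frobSq := by
      rw [← frobSq_conj _ hV', Matrix.mul_sub, Matrix.sub_mul, Matrix.mul_one, hV,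
        ← diagonal_one, ← diagonal_sub, ← hgram]
      simp only [conjTranspose_mul, Matrix.mul_assoc]
    rw [h1, h2, frobSq_diagonal, frobSq_diagonal]
    refine Finset.sum_le_sum fun k _ => ?_
    have e1 : Complex.normSq (1 - Real.sqrt (d k) : ℂ) = (1 - Real.sqrt (d k)) ^ 2 := by
      rw [show (1 - Real.sqrt (d k) : ℂ) = ((1 - Real.sqrt (d k) : ℝ) : ℂ) by push_cast; rfl,
        Complex.normSq_ofReal, sq]
    have e2 : Complex.normSq (d k - 1 : ℂ) = (d k - 1) ^ 2 := by
      rw [show (d k - 1 : ℂ) = ((d k - 1 : ℝ) : ℂ) by push_cast; rfl, Complex.normSq_ofReal, sq]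
    rw [e1, e2]
    have hs := Real.sqrt_nonneg (d k)
    have hss := Real.sq_sqrt (hd k)
    have : (d k - 1) ^ 2 = (1 - Real.sqrt (d k)) ^ 2 * (1 + Real.sqrt (d k)) ^ 2 := by
      nth_rewrite 1 [← hss]; ring
    rw [this]
    exact le_mul_of_one_le_right (sq_nonneg _) (by nlinarith)

end FrobeniusSquare

section Rounding

variable {ι A : Type*} [Fintype ι] [DecidableEq ι] [Fintype A]

lemma PosSemidef.quadraticForm_le {M : Matrix ι ι ℂ} (hM : M.PosSemidef) (v w : ι → ℂ) :
    (star w ⬝ᵥ (M *ᵥ w)).re ≤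
      2 * (star v ⬝ᵥ (M *ᵥ v)).re + 2 * (star (w - v) ⬝ᵥ (M *ᵥ (w - v))).re := by
  have h : 0 ≤ (star (w - v - v) ⬝ᵥ (M *ᵥ (w - v - v))).re := hM.re_dotProduct_nonneg _
  simp only [star_sub, mulVec_sub, sub_dotProduct, dotProduct_sub, Complex.sub_re] at h ⊢
  linarith

lemma PosSemidef.of_isHermitian_of_mul_self {r : Matrix ι ι ℂ} (h : r.IsHermitian)
    (h2 : r * r = r) : r.PosSemidef := by
  have := posSemidef_conjTranspose_mul_self r
  rwa [h.eq, h2] at this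

open scoped MatrixOrder in
lemma PosSemidef.exists_eq_conjTranspose_mul_self {P : Matrix ι ι ℂ} (hP : P.PosSemidef) :
    ∃ B : Matrix ι ι ℂ, P = Bᴴ * B :=
  CStarAlgebra.nonneg_iff_eq_star_mul_self.mp hP.nonneg

lemma PosSemidef.trace_mul_nonneg {P Q : Matrix ι ι ℂ} (hP : P.PosSemidef) (hQ : Q.PosSemidef) :
    0 ≤ (P * Q).trace.re := by
  obtain ⟨B, rfl⟩ := hP.exists_eq_conjTranspose_mul_self
  rw [Matrix.mul_assoc, trace_mul_comm, Matrix.mul_assoc, ← Matrix.mul_assoc]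
  exact (Complex.le_def.mp (hQ.mul_mul_conjTranspose_same B).trace_nonneg).1

lemma posSemidef_one_sub_of_sum_eq_one {P : A → Matrix ι ι ℂ} (hP : ∀ a, (P a).PosSemidef)
    (hsum : ∑ a, P a = 1) (a : A) : (1 - P a).PosSemidef := by
  classical
  rw [← hsum, ← Finset.sum_erase_eq_sub (Finset.mem_univ a)]
  exact posSemidef_sum _ fun b _ => hP b

lemma sum_sum_trace_mul_eq_card {P : A → Matrix ι ι ℂ} (hsum : ∑ a, P a = 1) :
    ∑ a, ∑ b, (P a * P b).trace.re = Fintype.card ι := by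
  have : ∑ a, ∑ b, (P a * P b).trace = Fintype.card ι := by
    simp_rw [← trace_sum, ← Finset.mul_sum, hsum, Matrix.mul_one, hsum, trace_one]
  have := congrArg Complex.re this
  simpa using this

lemma trace_diagonalization_mul {V U : Matrix ι ι ℂ} (d e : ι → ℝ) :
    ((V * diagonal (fun k => (d k : ℂ)) * Vᴴ) * (U * diagonal (fun k => (e k : ℂ)) * Uᴴ)).trace.re
      = ∑ k, ∑ l, d k * e l * Complex.normSq ((Vᴴ * U) k l) := by
  have h : ((V * diagonal (fun k => (d k : ℂ)) * Vᴴ) *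
      (U * diagonal (fun k => (e k : ℂ)) * Uᴴ)).trace =
      (diagonal (fun k => (d k : ℂ)) * (Vᴴ * U) * diagonal (fun k => (e k : ℂ)) *
        (Vᴴ * U)ᴴ).trace := by
    simp only [conjTranspose_mul, conjTranspose_conjTranspose, Matrix.mul_assoc]
    rw [trace_mul_comm V]
    simp only [Matrix.mul_assoc]
  rw [h]
  simp only [trace, diag, mul_apply (M := _ * _ * _), Complex.re_sum, mul_diagonal,
    diagonal_mul]
  refine Finset.sum_congr rfl fun k _ => Finset.sum_congr rfl fun l _ => ?_
  generalize (Vᴴ * U) = Z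
  simp [Complex.normSq_apply]
  ring

lemma exists_finset_card_le_of_spectrum (d : A → ι → ℝ) (hd : ∀ a k, 0 ≤ d a k)
    (hd1 : ∀ a k, d a k ≤ 1) (hsum : ∑ a, ∑ k, d a k = Fintype.card ι) :
    ∃ T : Finset (A × ι), (∀ t ∈ T, 1 / 2 < d t.1 t.2) ∧ T.card ≤ Fintype.card ι ∧
      (Fintype.card ι : ℝ) - T.card ≤ 2 * ∑ a, ∑ k, d a k * (1 - d a k) := by
  classical
  let T : Finset (A × ι) := Finset.univ.filter fun t => 1 / 2 < d t.1 t.2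
  have hnn : 0 ≤ ∑ a, ∑ k, d a k * (1 - d a k) :=
    Finset.sum_nonneg fun a _ => Finset.sum_nonneg fun k _ =>
      mul_nonneg (hd a k) (sub_nonneg.mpr (hd1 a k))
  by_cases hT : T.card ≤ Fintype.card ι
  · refine ⟨T, fun t ht => (Finset.mem_filter.mp ht).2, hT, ?_⟩
    have hcard : (T.card : ℝ) = ∑ a, ∑ k, if 1 / 2 < d a k then (1 : ℝ) else 0 := by
      rw [← Fintype.sum_prod_type' (f := fun a k => if 1 / 2 < d a k then (1 : ℝ) else 0),
        Finset.sum_boole]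
    rw [hcard, ← hsum, sub_le_iff_le_add, Finset.mul_sum, ← Finset.sum_add_distrib]
    refine Finset.sum_le_sum fun a _ => ?_
    rw [Finset.mul_sum, ← Finset.sum_add_distrib]
    refine Finset.sum_le_sum fun k _ => ?_
    have h0 := hd a k
    have h1 := hd1 a k
    split_ifs with h <;> nlinarith
  · obtain ⟨T', hT', hc⟩ := Finset.exists_subset_card_eq (le_of_not_ge hT)
    refine ⟨T', fun t ht => (Finset.mem_filter.mp (hT' ht)).2, hc.le, ?_⟩
    rw [hc, sub_self]
    positivity

/-- The Gram matrix of the dominant eigenvectors of a POVM, padded with zero vectors. -/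
lemma frobSq_gram_sub_one_le [DecidableEq A] {P V : A → Matrix ι ι ℂ} {d : A → ι → ℝ}
    (hsum : ∑ a, P a = 1) (hd : ∀ a k, 0 ≤ d a k) (hV : ∀ a, (V a)ᴴ * V a = 1)
    (htr : ∀ a b, (P a * P b).trace.re =
      ∑ k, ∑ l, d a k * d b l * Complex.normSq (((V a)ᴴ * V b) k l))
    (T : Finset (A × ι)) (hT : ∀ t ∈ T, 1 / 2 < d t.1 t.2) (hTcard : T.card ≤ Fintype.card ι) :
    let X : Matrix ι (T ⊕ Fin (Fintype.card ι - T.card)) ℂ :=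
      Matrix.of fun u => Sum.elim (fun t => V t.1.1 u t.1.2) 0
    (Xᴴ * X - 1).frobSq ≤ 4 * (Fintype.card ι - ∑ a, (P a * P a).trace.re) +
      (Fintype.card ι - T.card) := by
  intro X
  let κ := T ⊕ Fin (Fintype.card ι - T.card)
  have hll (t t' : T) : (Xᴴ * X - 1 : Matrix κ κ ℂ) (Sum.inl t) (Sum.inl t') =
      ((V t.1.1)ᴴ * V t'.1.1) t.1.2 t'.1.2 - if t = t' then 1 else 0 := by
    simp [X, mul_apply, one_apply]
  have hlr (t : T) (s) : (Xᴴ * X - 1 : Matrix κ κ ℂ) (Sum.inl t) (Sum.inr s) = 0 := by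
    simp [X, mul_apply]
  have hrl (t : T) (s) : (Xᴴ * X - 1 : Matrix κ κ ℂ) (Sum.inr s) (Sum.inl t) = 0 := by
    simp [X, mul_apply]
  have hrr (s s') : (Xᴴ * X - 1 : Matrix κ κ ℂ) (Sum.inr s) (Sum.inr s') =
      - if s = s' then 1 else 0 := by
    simp [X, mul_apply, one_apply]
  have hrrsum : ∑ s : Fin (Fintype.card ι - T.card), ∑ s',
      Complex.normSq (- if s = s' then 1 else 0) = Fintype.card ι - T.card := by
    simp [apply_ite Complex.normSq, Nat.cast_sub hTcard]
  simp only [frobSq, Fintype.sum_sum_type, κ, hll, hlr, hrl, hrr, map_zero,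
    Finset.sum_const_zero, add_zero, zero_add, hrrsum]
  let g : A × ι → A × ι → ℝ := fun t t' => if t.1 = t'.1 then 0 else
    4 * (d t.1 t.2 * d t'.1 t'.2 * Complex.normSq (((V t.1)ᴴ * V t'.1) t.2 t'.2))
  have hg0 (t t') : 0 ≤ g t t' := by
    simp only [g]
    split_ifs
    · exact le_rfl
    · have := hd t.1 t.2
      have := hd t'.1 t'.2
      have := Complex.normSq_nonneg (((V t.1)ᴴ * V t'.1) t.2 t'.2)
      positivity
  have hg (t t' : T) : Complex.normSq (((V t.1.1)ᴴ * V t'.1.1) t.1.2 t'.1.2 -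
      if t = t' then 1 else 0) ≤ g t t' := by
    obtain ⟨⟨a, k⟩, ht⟩ := t
    obtain ⟨⟨b, l⟩, ht'⟩ := t'
    by_cases hab : a = b
    · subst hab
      by_cases hkl : k = l <;> simp [g, hV, hkl]
    · have h1 := hT _ ht
      have h2 := hT _ ht'
      simp only at h1 h2
      have h3 : 1 ≤ 4 * (d a k * d b l) := by nlinarith
      simp only [g, hab, if_false, Subtype.mk.injEq, Prod.mk.injEq, false_and, sub_zero]
      rw [← mul_assoc]
      exact le_mul_of_one_le_left (Complex.normSq_nonneg _) h3
  have hsumg : ∑ t, ∑ t', g t t' = 4 * (Fintype.card ι - ∑ a, (P a * P a).trace.re) := by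
    have : ∑ t, ∑ t', g t t' =
        ∑ a, ∑ b, if a = b then 0 else 4 * (P a * P b).trace.re := by
      simp only [Fintype.sum_prod_type]
      refine Finset.sum_congr rfl fun a _ => ?_
      rw [Finset.sum_comm]
      refine Finset.sum_congr rfl fun b _ => ?_
      by_cases hab : a = b
      · simp [g, hab]
      · simp only [g, hab, if_false, htr, Finset.mul_sum]
    rw [this, ← sum_sum_trace_mul_eq_card hsum, ← Finset.sum_sub_distrib, Finset.mul_sum]
    refine Finset.sum_congr rfl fun a _ => ?_
    rw [← Finset.sum_erase_eq_sub (Finset.mem_univ a), Finset.mul_sum,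
      ← Finset.sum_erase_add _ _ (Finset.mem_univ a), if_pos rfl, add_zero]
    refine Finset.sum_congr rfl fun b hb => ?_
    rw [if_neg (Finset.ne_of_mem_erase hb).symm]
  have : ∑ t : T, ∑ t' : T, Complex.normSq (((V t.1.1)ᴴ * V t'.1.1) t.1.2 t'.1.2 -
      if t = t' then 1 else 0) ≤ 4 * (Fintype.card ι - ∑ a, (P a * P a).trace.re) := by
    rw [← hsumg]
    calc _ ≤ ∑ t : T, ∑ t' : T, g t t' :=
          Finset.sum_le_sum fun t _ => Finset.sum_le_sum fun t' _ => hg t t'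
      _ = ∑ t ∈ T, ∑ t' ∈ T, g t t' := by
          rw [← Finset.sum_coe_sort T]
          exact Finset.sum_congr rfl fun t _ => Finset.sum_coe_sort T (g t)
      _ ≤ ∑ t ∈ T, ∑ t', g t t' := Finset.sum_le_sum fun t _ =>
          Finset.sum_le_univ_sum_of_nonneg fun t' => hg0 _ _
      _ ≤ _ := Finset.sum_le_univ_sum_of_nonneg fun t =>
          Finset.sum_nonneg fun t' _ => hg0 _ _
  linarith

/-- A POVM which is close to being projective is close to a PVM on the same space. -/
lemma exists_pvm_near_povm [Nonempty A] (P : A → Matrix ι ι ℂ)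
    (hP : ∀ a, (P a).PosSemidef) (hsum : ∑ a, P a = 1) :
    ∃ r : A → Matrix ι ι ℂ, (∀ a, (r a).IsHermitian ∧ r a * r a = r a) ∧ ∑ a, r a = 1 ∧
      Fintype.card ι - ∑ a, (P a * r a).trace.re ≤
        16 * (Fintype.card ι - ∑ a, (P a * P a).trace.re) := by
  classical
  choose V d hV hV' hd hPd using fun a => (hP a).exists_diagonalization
  have hconj (a : A) : (V a)ᴴ * P a * V a = diagonal (fun k => (d a k : ℂ)) := by
    calc (V a)ᴴ * P a * V a
        = ((V a)ᴴ * V a) * diagonal (fun k => (d a k : ℂ)) * ((V a)ᴴ * V a) := by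
          conv_lhs => rw [hPd a]
          simp only [Matrix.mul_assoc]
      _ = _ := by rw [hV]; simp
  have hconj' (a : A) : (V a)ᴴ * (1 - P a) * V a = diagonal (fun k => (1 - d a k : ℂ)) := by
    rw [Matrix.mul_sub, Matrix.sub_mul, hconj, Matrix.mul_one, hV, ← diagonal_one, diagonal_sub]
  have hd1 (a : A) (k : ι) : d a k ≤ 1 := by
    have := ((posSemidef_one_sub_of_sum_eq_one hP hsum a).conjTranspose_mul_mul_same
        (V a)).diag_nonneg
      (i := k)
    rw [hconj', diagonal_apply_eq] at this
    have := (Complex.le_def.mp this).1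
    simpa using this
  have htr (a : A) : (P a).trace.re = ∑ k, d a k := by
    conv_lhs => rw [hPd a]
    rw [trace_mul_comm, ← Matrix.mul_assoc, hV, Matrix.one_mul, trace_diagonal]
    simp
  have htr2 (a b : A) : (P a * P b).trace.re =
      ∑ k, ∑ l, d a k * d b l * Complex.normSq (((V a)ᴴ * V b) k l) := by
    conv_lhs => rw [hPd a, hPd b]
    exact trace_diagonalization_mul _ _
  have hdsum : ∑ a, ∑ k, d a k = Fintype.card ι := by
    simp_rw [← htr, ← Complex.re_sum, ← trace_sum, hsum, trace_one]
    simp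
  set δ : ℝ := ∑ a, ∑ k, d a k * (1 - d a k) with hδ
  have hδ' : (Fintype.card ι : ℝ) - ∑ a, (P a * P a).trace.re = δ := by
    rw [← hdsum, hδ, ← Finset.sum_sub_distrib]
    refine Finset.sum_congr rfl fun a _ => ?_
    rw [htr2, hV, ← Finset.sum_sub_distrib]
    refine Finset.sum_congr rfl fun k _ => ?_
    rw [Finset.sum_eq_single k]
    · simp; ring
    · intro l _ hl
      simp [one_apply_ne' hl]
    · simp
  obtain ⟨T, hT, hTcard, hTn⟩ := exists_finset_card_le_of_spectrum d hd hd1 hdsum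
  rw [hδ']
  let κ := T ⊕ Fin (Fintype.card ι - T.card)
  have hκ : Fintype.card ι = Fintype.card κ := by simp [κ]; omega
  let X : Matrix ι κ ℂ := Matrix.of fun u => Sum.elim (fun t => V t.1.1 u t.1.2) 0
  let lab : κ → A := Sum.elim (fun t => t.1.1) fun _ => Classical.arbitrary A
  have hgram := frobSq_gram_sub_one_le hsum hd hV htr2 T hT hTcard
  rw [hδ'] at hgram
  obtain ⟨W, hW, hW', hWX⟩ := exists_unitary_frobSq_sub_le hκ X
  let E : A → Matrix κ κ ℂ := fun a => diagonal fun x => if lab x = a then 1 else 0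
  let r : A → Matrix ι ι ℂ := fun a => W * E a * Wᴴ
  have hquad (M : Matrix ι ι ℂ) (Z : Matrix ι κ ℂ) (x : κ) :
      (Zᴴ * M * Z) x x = star (Z.col x) ⬝ᵥ (M *ᵥ Z.col x) := by
    rw [Matrix.mul_assoc, mul_apply]
    rfl
  refine ⟨r, fun a => ⟨?_, ?_⟩, ?_, ?_⟩
  · refine isHermitian_mul_mul_conjTranspose _ ?_
    rw [IsHermitian, diagonal_conjTranspose]
    congr 1
    ext x
    by_cases h : lab x = a <;> simp [h]
  · calc r a * r a = W * (E a * (Wᴴ * W) *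
          E a) * Wᴴ := by
          simp only [r, Matrix.mul_assoc]
      _ = _ := by
          have hE : E a * E a = E a := by
            simp only [E]
            rw [diagonal_mul_diagonal]
            congr 1
            ext x
            split_ifs <;> simp
          rw [hW, Matrix.mul_one, hE]
  · simp only [r]
    rw [← Matrix.sum_mul, ← Matrix.mul_sum]
    have : ∑ a, E a = 1 := by
      ext x y
      rw [sum_apply]
      by_cases h : x = y
      · subst h; simp [E]
      · simp [E, h]
    rw [this, Matrix.mul_one, hW']
  · have h1 : ∑ a, (P a * r a).trace.re = ∑ x, ((Wᴴ * P (lab x) * W) x x).re := by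
      have (a : A) : (P a * r a).trace.re =
          ∑ x, if lab x = a then ((Wᴴ * P (lab x) * W) x x).re else 0 := by
        have : (P a * r a).trace = (Wᴴ * P a * W *
            E a).trace := by
          simp only [r]
          rw [← Matrix.mul_assoc, trace_mul_comm]
          simp only [Matrix.mul_assoc]
        rw [this, trace, Complex.re_sum]
        refine Finset.sum_congr rfl fun x _ => ?_
        by_cases h : lab x = a <;> simp [E, h]
      simp_rw [this]
      rw [Finset.sum_comm]
      simp
    have h2 : (Fintype.card ι : ℝ) - ∑ a, (P a * r a).trace.re =
        ∑ x, ((Wᴴ * (1 - P (lab x)) * W : Matrix κ κ ℂ) x x).re := by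
      have hc : (Fintype.card ι : ℝ) = ∑ _x : κ, (1 : ℝ) := (congrArg Nat.cast hκ).trans (by simp)
      rw [h1, hc, ← Finset.sum_sub_distrib]
      simp [Matrix.mul_sub, Matrix.sub_mul, hW]
    have h3 (x : κ) : ((Wᴴ * (1 - P (lab x)) * W : Matrix κ κ ℂ) x x).re ≤
        2 * ((Xᴴ * (1 - P (lab x)) * X : Matrix κ κ ℂ) x x).re +
          2 * ∑ u, Complex.normSq ((W - X) u x) := by
      rw [hquad, hquad]
      refine ((posSemidef_one_sub_of_sum_eq_one hP hsum (lab x)).quadraticForm_le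
        (X.col x) (W.col x)).trans ?_
      gcongr
      have h0 : 0 ≤ (star (W.col x - X.col x) ⬝ᵥ (P (lab x) *ᵥ (W.col x - X.col x))).re :=
        (hP (lab x)).re_dotProduct_nonneg _
      rw [sub_mulVec, dotProduct_sub, Complex.sub_re, one_mulVec]
      have : (star (W.col x - X.col x) ⬝ᵥ (W.col x - X.col x)).re =
          ∑ u, Complex.normSq ((W - X) u x) := by
        simp only [dotProduct, Complex.re_sum]
        refine Finset.sum_congr rfl fun u _ => ?_
        simp [Complex.normSq_apply]
        ring
      linarith
    have h4 : ∑ x, ((Xᴴ * (1 - P (lab x)) * X : Matrix κ κ ℂ) x x).re ≤ 2 * δ := by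
      have hl (t : T) :
          ((Xᴴ * (1 - P (lab (Sum.inl t))) * X : Matrix κ κ ℂ) (Sum.inl t) (Sum.inl t)).re =
          1 - d t.1.1 t.1.2 := by
        have e1 : (Xᴴ * (1 - P (lab (Sum.inl t))) * X : Matrix κ κ ℂ) (Sum.inl t) (Sum.inl t) =
            ((V t.1.1)ᴴ * (1 - P t.1.1) * V t.1.1) t.1.2 t.1.2 := rfl
        rw [e1, hconj', diagonal_apply_eq]
        simp
      have hr (s) :
          ((Xᴴ * (1 - P (lab (Sum.inr s))) * X : Matrix κ κ ℂ) (Sum.inr s) (Sum.inr s)).re = 0 := by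
        rw [mul_apply]
        simp [X]
      simp only [κ, Fintype.sum_sum_type, hl, hr, Finset.sum_const_zero, add_zero]
      rw [Finset.sum_coe_sort T fun t => 1 - d t.1 t.2, hδ, Finset.mul_sum]
      simp_rw [Finset.mul_sum]
      rw [← Fintype.sum_prod_type' (f := fun a k => 2 * (d a k * (1 - d a k)))]
      calc _ ≤ ∑ t ∈ T, 2 * (d t.1 t.2 * (1 - d t.1 t.2)) := Finset.sum_le_sum fun t ht => by
            nlinarith [hT t ht, hd1 t.1 t.2]
        _ ≤ _ := Finset.sum_le_univ_sum_of_nonneg fun t =>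
            mul_nonneg zero_le_two (mul_nonneg (hd _ _) (sub_nonneg.mpr (hd1 _ _)))
    have h5 : ∑ x, ∑ u, Complex.normSq ((W - X) u x) = (W - X).frobSq := Finset.sum_comm
    have h6 := Finset.sum_le_sum fun x (_ : x ∈ Finset.univ) => h3 x
    rw [Finset.sum_add_distrib, ← Finset.mul_sum, ← Finset.mul_sum, h5] at h6
    rw [h2]
    linarith

end Rounding

section WeightedTrace

variable {ι A B : Type*} [Fintype ι] [Fintype A] [Fintype B]

/-- The bilinear form `∑ k l, w k l * Re (X k l * Y l k)`. -/
noncomputable def weightedTrace (w : ι → ι → ℝ) : Matrix ι ι ℂ →ₗ[ℝ] Matrix ι ι ℂ →ₗ[ℝ] ℝ :=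
  LinearMap.mk₂ ℝ (fun X Y => ∑ k, ∑ l, w k l * (X k l * Y l k).re)
    (fun X X' Y => by simp only [add_apply, add_mul, Complex.add_re, mul_add,
      Finset.sum_add_distrib])
    (fun r X Y => by simp only [smul_apply, smul_mul_assoc, Complex.smul_re, smul_eq_mul,
      Finset.mul_sum, mul_left_comm])
    (fun X Y Y' => by simp only [add_apply, mul_add, Complex.add_re, Finset.sum_add_distrib])
    (fun r X Y => by simp only [smul_apply, mul_smul_comm, Complex.smul_re, smul_eq_mul,
      Finset.mul_sum, mul_left_comm])

lemma weightedTrace_apply (w : ι → ι → ℝ) (X Y : Matrix ι ι ℂ) :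
    weightedTrace w X Y = ∑ k, ∑ l, w k l * (X k l * Y l k).re := rfl

lemma IsHermitian.mul_apply_re {X : Matrix ι ι ℂ} (hX : X.IsHermitian) (k l : ι) :
    (X k l * X l k).re = Complex.normSq (X k l) := by
  rw [← hX.apply l k]
  simp [Complex.normSq_apply]

lemma weightedTrace_self (w : ι → ι → ℝ) {X : Matrix ι ι ℂ} (hX : X.IsHermitian) :
    weightedTrace w X X = ∑ k, ∑ l, w k l * Complex.normSq (X k l) := by
  simp only [weightedTrace_apply, hX.mul_apply_re]

lemma weightedTrace_self_nonneg {w : ι → ι → ℝ} (hw : ∀ k l, 0 ≤ w k l) {X : Matrix ι ι ℂ}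
    (hX : X.IsHermitian) : 0 ≤ weightedTrace w X X := by
  rw [weightedTrace_self w hX]
  exact Finset.sum_nonneg fun k _ => Finset.sum_nonneg fun l _ =>
    mul_nonneg (hw k l) (Complex.normSq_nonneg _)

lemma weightedTrace_comm {w : ι → ι → ℝ} (hw : ∀ k l, w k l = w l k) (X Y : Matrix ι ι ℂ) :
    weightedTrace w X Y = weightedTrace w Y X := by
  rw [weightedTrace_apply, weightedTrace_apply, Finset.sum_comm]
  refine Finset.sum_congr rfl fun k _ => Finset.sum_congr rfl fun l _ => ?_
  rw [hw, mul_comm (X l k)]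

lemma weightedTrace_const_one (X Y : Matrix ι ι ℂ) :
    weightedTrace (fun _ _ => 1 * 1) X Y = (X * Y).trace.re := by
  simp [weightedTrace_apply, trace, mul_apply]

lemma weightedTrace_one_one [DecidableEq ι] (w : ι → ι → ℝ) :
    weightedTrace w 1 1 = ∑ k, w k k := by
  rw [weightedTrace_apply]
  refine Finset.sum_congr rfl fun k _ => ?_
  rw [Finset.sum_eq_single k] <;> simp +contextual [one_apply_ne']

lemma weightedTrace_mul_eq_trace [DecidableEq ι] (u : ι → ℝ) (X Y : Matrix ι ι ℂ) :
    weightedTrace (fun k l => u k * u l) X Y =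
      (diagonal (fun k => (u k : ℂ)) * X * diagonal (fun k => (u k : ℂ)) * Y).trace.re := by
  rw [weightedTrace_apply, trace, Complex.re_sum]
  refine Finset.sum_congr rfl fun k _ => ?_
  rw [diag, mul_apply, Complex.re_sum]
  refine Finset.sum_congr rfl fun l _ => ?_
  rw [mul_diagonal, diagonal_mul]
  simp
  ring

lemma weightedTrace_nonneg [DecidableEq ι] (u : ι → ℝ) {X Y : Matrix ι ι ℂ}
    (hX : X.PosSemidef) (hY : Y.PosSemidef) :
    0 ≤ weightedTrace (fun k l => u k * u l) X Y := by
  rw [weightedTrace_mul_eq_trace]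
  refine PosSemidef.trace_mul_nonneg ?_ hY
  have h := hX.mul_mul_conjTranspose_same (diagonal fun k => (u k : ℂ))
  have hu : star (fun k => (u k : ℂ)) = fun k => (u k : ℂ) := by
    ext k
    simp
  rwa [diagonal_conjTranspose, hu] at h

lemma sum_weightedTrace_comp [DecidableEq B] (w : ι → ι → ℝ) (f : A → B)
    (P : A → Matrix ι ι ℂ) (Y : B → Matrix ι ι ℂ) :
    ∑ a, weightedTrace w (P a) (Y (f a)) =
      ∑ b, weightedTrace w (∑ a with f a = b, P a) (Y b) := by
  rw [← Finset.sum_fiberwise (s := Finset.univ) (g := f)]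
  refine Finset.sum_congr rfl fun b _ => ?_
  rw [map_sum, LinearMap.sum_apply]
  refine Finset.sum_congr rfl fun a ha => ?_
  rw [(Finset.mem_filter.mp ha).2]

lemma sum_weightedTrace_fiber [DecidableEq B] (w : ι → ι → ℝ) (f : A → B)
    (P R : A → Matrix ι ι ℂ) :
    ∑ b, weightedTrace w (∑ a with f a = b, P a) (∑ a with f a = b, R a) =
      ∑ a, ∑ a', if f a = f a' then weightedTrace w (P a) (R a') else 0 := by
  rw [← sum_weightedTrace_comp w f P fun b => ∑ a with f a = b, R a]
  refine Finset.sum_congr rfl fun a _ => ?_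
  rw [map_sum, Finset.sum_filter]
  simp only [eq_comm]

lemma sum_sum_weightedTrace [DecidableEq ι] (w : ι → ι → ℝ) {P : A → Matrix ι ι ℂ}
    (hsum : ∑ a, P a = 1) :
    ∑ a, ∑ a', weightedTrace w (P a) (P a') = ∑ k, w k k := by
  simp_rw [← map_sum, hsum, ← LinearMap.sum_apply, ← map_sum, hsum, weightedTrace_one_one]

lemma sum_weightedTrace_le_fiber [DecidableEq ι] [DecidableEq B] (u : ι → ℝ) (f : A → B)
    {P R : A → Matrix ι ι ℂ} (hP : ∀ a, (P a).PosSemidef) (hR : ∀ a, (R a).PosSemidef) :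
    ∑ a, weightedTrace (fun k l => u k * u l) (P a) (R a) ≤
      ∑ b, weightedTrace (fun k l => u k * u l) (∑ a with f a = b, P a)
        (∑ a with f a = b, R a) := by
  rw [sum_weightedTrace_fiber]
  refine Finset.sum_le_sum fun a _ => ?_
  refine le_trans (le_of_eq (if_pos rfl).symm) (Finset.single_le_sum (f := fun a' =>
    if f a = f a' then weightedTrace (fun k l => u k * u l) (P a) (R a') else 0)
    (fun a' _ => ?_) (Finset.mem_univ a))
  split_ifs
  exacts [weightedTrace_nonneg u (hP a) (hR a'), le_rfl]

lemma sum_weightedTrace_self_le [DecidableEq ι] (u : ι → ℝ) {P : A → Matrix ι ι ℂ}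
    (hP : ∀ a, (P a).PosSemidef) (hsum : ∑ a, P a = 1) :
    ∑ a, weightedTrace (fun k l => u k * u l) (P a) (P a) ≤ ∑ k, u k * u k := by
  rw [← sum_sum_weightedTrace (fun k l => u k * u l) hsum]
  exact Finset.sum_le_sum fun a _ => Finset.single_le_sum
    (fun a' _ => weightedTrace_nonneg u (hP a) (hP a')) (Finset.mem_univ a)

lemma posSemidef_sum_fiber [DecidableEq B] (f : A → B) {P : A → Matrix ι ι ℂ}
    (hP : ∀ a, (P a).PosSemidef) (b : B) : (∑ a with f a = b, P a).PosSemidef :=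
  posSemidef_sum _ fun a _ => hP a

lemma sum_sum_fiber [DecidableEq ι] [DecidableEq B] (f : A → B) {P : A → Matrix ι ι ℂ}
    (hsum : ∑ a, P a = 1) : ∑ b, ∑ a with f a = b, P a = 1 := by
  rw [Finset.sum_fiberwise, hsum]

lemma weightedTrace_sub_self {w : ι → ι → ℝ} (hw : ∀ k l, w k l = w l k) (X Y : Matrix ι ι ℂ) :
    weightedTrace w (X - Y) (X - Y) =
      weightedTrace w X X + weightedTrace w Y Y - 2 * weightedTrace w X Y := by
  simp only [map_sub, LinearMap.sub_apply, weightedTrace_comm hw Y X]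
  ring

/-- Two POVMs which are almost perfectly correlated are both almost projective. -/
lemma sub_sum_weightedTrace_self_le [DecidableEq ι] {u : ι → ℝ} (hu : ∀ k, 0 ≤ u k)
    {P Y : B → Matrix ι ι ℂ} (hP : ∀ b, (P b).IsHermitian) (hY : ∀ b, (Y b).PosSemidef)
    (hYsum : ∑ b, Y b = 1) :
    ∑ k, u k * u k - ∑ b, weightedTrace (fun k l => u k * u l) (P b) (P b) ≤
      2 * (∑ k, u k * u k - ∑ b, weightedTrace (fun k l => u k * u l) (P b) (Y b)) := by
  have h0 : 0 ≤ ∑ b, weightedTrace (fun k l => u k * u l) (P b - Y b) (P b - Y b) :=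
    Finset.sum_nonneg fun b _ => weightedTrace_self_nonneg
      (fun k l => mul_nonneg (hu k) (hu l)) ((hP b).sub (hY b).1)
  simp only [weightedTrace_sub_self (fun k l => mul_comm (u k) (u l)), Finset.sum_sub_distrib,
    Finset.sum_add_distrib, ← Finset.mul_sum] at h0
  have := sum_weightedTrace_self_le u hY hYsum
  linarith

/-- A POVM is almost projective when sufficiently many of its coarse-grainings are. -/
lemma sub_sum_weightedTrace_self_le_sum [DecidableEq ι] {J : Type*} {B : J → Type*}
    [∀ j, Fintype (B j)] [∀ j, DecidableEq (B j)] (u : ι → ℝ)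
    {P : A → Matrix ι ι ℂ} (hP : ∀ a, (P a).PosSemidef) (hsum : ∑ a, P a = 1)
    (T : Finset J) (f : ∀ j, A → B j) (hf : ∀ a a', (∀ j ∈ T, f j a = f j a') → a = a') :
    ∑ k, u k * u k - ∑ a, weightedTrace (fun k l => u k * u l) (P a) (P a) ≤
      ∑ j ∈ T, (∑ k, u k * u k - ∑ b, weightedTrace (fun k l => u k * u l)
        (∑ a with f j a = b, P a) (∑ a with f j a = b, P a)) := by
  classical
  set w := fun k l => u k * u l
  have hdiag : ∑ a, weightedTrace w (P a) (P a) =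
      ∑ a, ∑ a', if a = a' then weightedTrace w (P a) (P a') else 0 := by simp
  simp only [sum_weightedTrace_fiber]
  rw [hdiag, ← sum_sum_weightedTrace w hsum]
  simp only [← Finset.sum_sub_distrib]
  rw [Finset.sum_comm (s := T)]
  refine Finset.sum_le_sum fun a _ => ?_
  rw [Finset.sum_comm (s := T)]
  refine Finset.sum_le_sum fun a' _ => ?_
  have h0 : 0 ≤ weightedTrace w (P a) (P a') := weightedTrace_nonneg u (hP a) (hP a')
  have hterm : ∀ j ∈ T, 0 ≤ weightedTrace w (P a) (P a') -
      if f j a = f j a' then weightedTrace w (P a) (P a') else 0 := fun j _ => by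
    split_ifs <;> simp [h0]
  by_cases h : a = a'
  · rw [if_pos h, sub_self]
    refine Finset.sum_nonneg fun j hj => ?_
    exact hterm j hj
  · obtain ⟨j, hj, hne⟩ : ∃ j ∈ T, f j a ≠ f j a' := by
      by_contra! hcon
      exact h (hf a a' hcon)
    refine le_trans (le_of_eq ?_) (Finset.single_le_sum (f := fun j =>
      weightedTrace w (P a) (P a') - if f j a = f j a' then weightedTrace w (P a) (P a') else 0)
      hterm hj)
    simp only [if_neg h, if_neg hne]

/-- The correlation of two PVMs is controlled by that of two POVMs close to them. -/
lemma card_sub_sum_trace_le [DecidableEq ι] [DecidableEq B] (f : A → B)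
    {P r : A → Matrix ι ι ℂ} {Y s : B → Matrix ι ι ℂ}
    (hP : ∀ a, (P a).PosSemidef) (hPsum : ∑ a, P a = 1)
    (hY : ∀ b, (Y b).PosSemidef) (hYsum : ∑ b, Y b = 1)
    (hr : ∀ a, (r a).IsHermitian ∧ r a * r a = r a) (hrsum : ∑ a, r a = 1)
    (hs : ∀ b, (s b).IsHermitian ∧ s b * s b = s b) (hssum : ∑ b, s b = 1) :
    Fintype.card ι - ∑ a, (r a * s (f a)).trace.re ≤
      3 * ((Fintype.card ι - ∑ a, (P a * r a).trace.re) +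
        (Fintype.card ι - ∑ a, (P a * Y (f a)).trace.re) +
        (Fintype.card ι - ∑ b, (Y b * s b).trace.re)) := by
  let w : ι → ι → ℝ := fun _ _ => 1 * 1
  have hcard : (Fintype.card ι : ℝ) = ∑ _k : ι, (1 : ℝ) * 1 := by simp
  have hr' a := PosSemidef.of_isHermitian_of_mul_self (hr a).1 (hr a).2
  have hs' b := PosSemidef.of_isHermitian_of_mul_self (hs b).1 (hs b).2
  let Pc : B → Matrix ι ι ℂ := fun b => ∑ a with f a = b, P a
  let rc : B → Matrix ι ι ℂ := fun b => ∑ a with f a = b, r a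
  have hrr : Fintype.card ι ≤ ∑ b, weightedTrace w (rc b) (rc b) := by
    refine le_trans (le_of_eq ?_) (sum_weightedTrace_le_fiber (fun _ => 1) f hr' hr')
    simp only [weightedTrace_const_one, (hr _).2, ← Complex.re_sum, ← trace_sum, hrsum, trace_one,
      Complex.natCast_re]
  have hss : Fintype.card ι = ∑ b, weightedTrace w (s b) (s b) := by
    simp only [w, weightedTrace_const_one, (hs _).2, ← Complex.re_sum, ← trace_sum, hssum,
      trace_one, Complex.natCast_re]
  have hrr' : ∑ b, weightedTrace w (rc b) (rc b) ≤ Fintype.card ι := by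
    rw [hcard]
    exact sum_weightedTrace_self_le (fun _ => 1) (posSemidef_sum_fiber f hr')
      (sum_sum_fiber f hrsum)
  have hPP : ∑ b, weightedTrace w (Pc b) (Pc b) ≤ Fintype.card ι := by
    rw [hcard]
    exact sum_weightedTrace_self_le (fun _ => 1) (posSemidef_sum_fiber f hP)
      (sum_sum_fiber f hPsum)
  have hYY : ∑ b, weightedTrace w (Y b) (Y b) ≤ Fintype.card ι := by
    rw [hcard]
    exact sum_weightedTrace_self_le (fun _ => 1) hY hYsum
  have hPr : ∑ a, (P a * r a).trace.re ≤ ∑ b, weightedTrace w (Pc b) (rc b) := by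
    simp only [← weightedTrace_const_one]
    exact sum_weightedTrace_le_fiber (fun _ => 1) f hP hr'
  have hPY : ∑ a, (P a * Y (f a)).trace.re = ∑ b, weightedTrace w (Pc b) (Y b) := by
    simp only [← weightedTrace_const_one]
    exact sum_weightedTrace_comp w f P Y
  have hrs : ∑ a, (r a * s (f a)).trace.re = ∑ b, weightedTrace w (rc b) (s b) := by
    simp only [← weightedTrace_const_one]
    exact sum_weightedTrace_comp w f r s
  have hYs : ∑ b, (Y b * s b).trace.re = ∑ b, weightedTrace w (Y b) (s b) := by
    simp only [← weightedTrace_const_one, w]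
  have hw : ∀ k l, w k l = w l k := fun _ _ => rfl
  have hw0 : ∀ k l, 0 ≤ w k l := fun _ _ => by simp [w]
  have htri (b : B) : weightedTrace w (rc b - s b) (rc b - s b) ≤
      3 * (weightedTrace w (Pc b - rc b) (Pc b - rc b) +
        weightedTrace w (Pc b - Y b) (Pc b - Y b) + weightedTrace w (Y b - s b) (Y b - s b)) := by
    have h1 : (Pc b - rc b).IsHermitian :=
      (posSemidef_sum_fiber f hP b).1.sub (posSemidef_sum_fiber f hr' b).1
    have h2 : (Pc b - Y b).IsHermitian := (posSemidef_sum_fiber f hP b).1.sub (hY b).1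
    have h3 : (Y b - s b).IsHermitian := (hY b).1.sub (hs b).1
    have e1 := weightedTrace_self_nonneg hw0 (h1.add h2)
    have e2 := weightedTrace_self_nonneg hw0 (h1.add h3)
    have e3 := weightedTrace_self_nonneg hw0 (h2.sub h3)
    have e : rc b - s b = (Pc b - Y b) + (Y b - s b) - (Pc b - rc b) := by abel
    rw [e]
    generalize Pc b - rc b = x at *
    generalize Pc b - Y b = y at *
    generalize Y b - s b = z at *
    simp only [map_add, map_sub, LinearMap.add_apply, LinearMap.sub_apply,
      weightedTrace_comm hw y x, weightedTrace_comm hw z x, weightedTrace_comm hw z y]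
      at e1 e2 e3 ⊢
    linarith
  have h := Finset.sum_le_sum fun b (_ : b ∈ Finset.univ) => htri b
  simp only [weightedTrace_sub_self hw, ← Finset.mul_sum, Finset.sum_add_distrib,
    Finset.sum_sub_distrib] at h
  rw [hrs, hPY, hYs]
  linarith

end WeightedTrace

end Matrix

section Layers

variable {ι : Type*} [Fintype ι]

/-- The layer-cake principle for the kernel `min (v k) (v l)`: an inequality for all indicator
functions of nonempty sets passes to all nonnegative functions. -/
lemma sum_mul_min_lt_of_forall_finset (c : ι → ι → ℝ) (b : ℝ)
    (hc : ∀ S : Finset ι, S.Nonempty → ∑ k ∈ S, ∑ l ∈ S, c k l < b * S.card)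
    (v : ι → ℝ) (hv : ∀ k, 0 ≤ v k) (hv0 : v ≠ 0) :
    ∑ k, ∑ l, c k l * min (v k) (v l) < b * ∑ k, v k := by
  classical
  induction h : (Finset.univ.filter fun k => 0 < v k).card using Nat.strong_induction_on
    generalizing v with
  | _ n ih =>
  set T := Finset.univ.filter fun k => 0 < v k with hTdef
  have hT (k : ι) : k ∈ T ↔ 0 < v k := by simp [hTdef]
  obtain ⟨k₀, hk₀⟩ := Function.ne_iff.mp hv0
  have hTne : T.Nonempty := ⟨k₀, (hT k₀).mpr (lt_of_le_of_ne (hv k₀) (Ne.symm hk₀))⟩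
  obtain ⟨x, hx, hmin⟩ := T.exists_min_image v hTne
  have hvx := (hT x).mp hx
  let v' : ι → ℝ := fun k => v k - if k ∈ T then v x else 0
  have hnot {k : ι} (hk : k ∉ T) : v k = 0 := le_antisymm (not_lt.mp (mt (hT k).mpr hk)) (hv k)
  have hv' (k : ι) : 0 ≤ v' k := by
    by_cases hk : k ∈ T
    · simpa [v', hk] using hmin k hk
    · simpa [v', hk] using hv k
  have hsum : ∑ k, v k = ∑ k, v' k + v x * T.card := by
    simp only [v', Finset.sum_sub_distrib, Finset.sum_ite_mem, Finset.univ_inter,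
      Finset.sum_const, nsmul_eq_mul]
    ring
  have hsum2 : ∑ k, ∑ l, c k l * min (v k) (v l) =
      ∑ k, ∑ l, c k l * min (v' k) (v' l) + v x * ∑ k ∈ T, ∑ l ∈ T, c k l := by
    have hite : ∑ k ∈ T, ∑ l ∈ T, c k l = ∑ k, ∑ l, if k ∈ T ∧ l ∈ T then c k l else 0 := by
      simp only [ite_and, Finset.sum_ite_mem, Finset.univ_inter, Finset.sum_ite_irrel,
        Finset.sum_const_zero]
    rw [hite, Finset.mul_sum, ← Finset.sum_add_distrib]
    refine Finset.sum_congr rfl fun k _ => ?_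
    rw [Finset.mul_sum, ← Finset.sum_add_distrib]
    refine Finset.sum_congr rfl fun l _ => ?_
    by_cases hk : k ∈ T
    · by_cases hl : l ∈ T
      · simp only [v', hk, hl, if_true, and_self, min_sub_sub_right]
        ring
      · have := hv' k
        simp only [v', hk, if_true] at this
        simp [v', hk, hl, hnot hl, hv k, this]
    · by_cases hl : l ∈ T
      · have := hv' l
        simp only [v', hl, if_true] at this
        simp [v', hk, hl, hnot hk, hv l, this]
      · simp [v', hk, hl]
  have hlt := mul_lt_mul_of_pos_left (hc T hTne) hvx
  have hle : ∑ k, ∑ l, c k l * min (v' k) (v' l) ≤ b * ∑ k, v' k := by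
    by_cases h0 : v' = 0
    · simp [h0]
    · refine (ih _ ?_ v' hv' h0 rfl).le
      rw [← h]
      refine Finset.card_lt_card (Finset.ssubset_iff_of_subset ?_ |>.mpr ⟨x, hx, ?_⟩)
      · intro k hk
        by_contra hkT
        simp [v', hkT, hnot hkT] at hk
      · simp [v', hx]
  rw [hsum, hsum2, mul_add]
  linarith

lemma exists_finset_of_le_sum_mul_min (c : ι → ι → ℝ) (b : ℝ) (v : ι → ℝ) (hv : ∀ k, 0 ≤ v k)
    (hv0 : v ≠ 0) (h : b * ∑ k, v k ≤ ∑ k, ∑ l, c k l * min (v k) (v l)) :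
    ∃ S : Finset ι, S.Nonempty ∧ b * S.card ≤ ∑ k ∈ S, ∑ l ∈ S, c k l := by
  by_contra! hcon
  exact (sum_mul_min_lt_of_forall_finset c b hcon v hv hv0).not_ge h

end Layers

namespace Matrix

section WeightChange

variable {ι A B : Type*} [Fintype ι] [Fintype A] [Fintype B]

/-- The weighted trace as a linear function of the weight. -/
noncomputable def weightedTraceOfWeight (X Y : Matrix ι ι ℂ) : (ι → ι → ℝ) →ₗ[ℝ] ℝ where
  toFun w := weightedTrace w X Y
  map_add' w w' := by
    simp only [weightedTrace_apply, Pi.add_apply, add_mul, Finset.sum_add_distrib]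
  map_smul' r w := by
    simp only [weightedTrace_apply, Pi.smul_apply, smul_eq_mul, mul_assoc, Finset.mul_sum,
      RingHom.id_apply]

lemma weightedTraceOfWeight_apply (X Y : Matrix ι ι ℂ) (w : ι → ι → ℝ) :
    weightedTraceOfWeight X Y w = weightedTrace w X Y := rfl

lemma weightedTrace_sub_weight (w w' : ι → ι → ℝ) (X Y : Matrix ι ι ℂ) :
    weightedTrace (w - w') X Y = weightedTrace w X Y - weightedTrace w' X Y :=
  map_sub (weightedTraceOfWeight X Y) w w'

lemma PosSemidef.sub_mul_self [DecidableEq ι] {P : Matrix ι ι ℂ} (hP : P.PosSemidef)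
    (hP1 : (1 - P).PosSemidef) : (P - P * P).PosSemidef := by
  have h1 := hP1.mul_mul_conjTranspose_same P
  have h2 := hP.mul_mul_conjTranspose_same (1 - P)
  rw [hP.1.eq] at h1
  rw [hP1.1.eq] at h2
  convert h1.add h2 using 1
  noncomm_ring

lemma sum_sum_normSq_le_one [DecidableEq ι] {P : A → Matrix ι ι ℂ}
    (hP : ∀ a, (P a).PosSemidef) (hsum : ∑ a, P a = 1) (k : ι) :
    ∑ l, ∑ a, Complex.normSq (P a k l) ≤ 1 := by
  have h (a : A) : ∑ l, Complex.normSq (P a k l) ≤ (P a k k).re := by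
    have h0 := ((hP a).sub_mul_self (posSemidef_one_sub_of_sum_eq_one hP hsum a)).diag_nonneg
      (i := k)
    have h1 := (Complex.le_def.mp h0).1
    rw [sub_apply, mul_apply, Complex.sub_re, Complex.re_sum] at h1
    simp only [(hP a).1.mul_apply_re] at h1
    simpa using h1
  rw [Finset.sum_comm]
  refine (Finset.sum_le_sum fun a _ => h a).trans (le_of_eq ?_)
  rw [← Complex.re_sum, ← sum_apply, hsum]
  simp

/-- The difference of the geometric mean and the minimum of `u k ^ 2` and `u l ^ 2`. -/
noncomputable def geomSubMin (u : ι → ℝ) : ι → ι → ℝ :=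
  (fun k l => u k * u l) - fun k l => min (u k * u k) (u l * u l)

lemma geomSubMin_comm (u : ι → ℝ) (k l : ι) : geomSubMin u k l = geomSubMin u l k := by
  simp only [geomSubMin, Pi.sub_apply, mul_comm (u k) (u l), min_comm (u k * u k)]

lemma geomSubMin_nonneg {u : ι → ℝ} (hu : ∀ k, 0 ≤ u k) (k l : ι) : 0 ≤ geomSubMin u k l := by
  simp only [geomSubMin, Pi.sub_apply, sub_nonneg]
  rcases le_total (u k) (u l) with h | h
  · exact (min_le_left _ _).trans (mul_le_mul_of_nonneg_left h (hu k))
  · exact (min_le_right _ _).trans (mul_le_mul_of_nonneg_right h (hu l))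

lemma geomSubMin_le {u : ι → ℝ} (hu : ∀ k, 0 ≤ u k) {θ : ℝ} (hθ : 0 < θ) (k l : ι) :
    geomSubMin u k l ≤ (u k - u l) ^ 2 / (4 * θ) + θ * (u k + u l) ^ 2 / 4 := by
  have key : ∀ {x y : ℝ}, 0 ≤ x → x ≤ y →
      x * y - x * x ≤ (x - y) ^ 2 / (4 * θ) + θ * (x + y) ^ 2 / 4 := fun {x y} hx hxy => by
    have h1 : (y - x) * (x + y) / 2 ≤ (x - y) ^ 2 / (4 * θ) + θ * (x + y) ^ 2 / 4 := by
      have : (x - y) ^ 2 / (4 * θ) + θ * (x + y) ^ 2 / 4 - (y - x) * (x + y) / 2 =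
          ((y - x) - θ * (x + y)) ^ 2 / (4 * θ) := by
        field_simp
        ring
      have h2 : 0 ≤ ((y - x) - θ * (x + y)) ^ 2 / (4 * θ) := by positivity
      linarith
    nlinarith [sq_nonneg (x - y)]
  rcases le_total (u k) (u l) with h | h
  · have := key (hu k) h
    simpa only [geomSubMin, Pi.sub_apply, min_eq_left (mul_self_le_mul_self (hu k) h)] using this
  · have := key (hu l) h
    rw [geomSubMin_comm]
    simp only [geomSubMin, Pi.sub_apply, min_eq_left (mul_self_le_mul_self (hu l) h)]
    convert this using 2
    · congr 1
      ring
    · congr 3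
      ring

lemma sum_weightedTrace_geomSubMin_le [DecidableEq ι] {u : ι → ℝ} (hu : ∀ k, 0 ≤ u k)
    (hu1 : ∑ k, u k * u k = 1) {P : A → Matrix ι ι ℂ}
    (hP : ∀ a, (P a).PosSemidef) (hsum : ∑ a, P a = 1) {δ θ : ℝ} (hθ : 0 < θ)
    (hδ : 1 - δ ≤ ∑ a, weightedTrace (fun k l => u k * u l) (P a) (P a)) :
    ∑ a, weightedTrace (geomSubMin u) (P a) (P a) ≤ δ / (2 * θ) + θ := by
  let m : ι → ι → ℝ := fun k l => ∑ a, Complex.normSq (P a k l)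
  have hm0 (k l : ι) : 0 ≤ m k l := Finset.sum_nonneg fun a _ => Complex.normSq_nonneg _
  have hm (k l : ι) : m k l = m l k := Finset.sum_congr rfl fun a _ => by
    rw [← (hP a).1.apply k l, ← Complex.normSq_conj]
    simp
  have hsumm (w : ι → ι → ℝ) : ∑ a, weightedTrace w (P a) (P a) = ∑ k, ∑ l, w k l * m k l := by
    simp only [weightedTrace_self w (hP _).1, m, Finset.mul_sum]
    rw [Finset.sum_comm]
    exact Finset.sum_congr rfl fun k _ => Finset.sum_comm
  have hrow : ∑ k, ∑ l, u k * u k * m k l ≤ 1 := by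
    rw [← hu1]
    refine Finset.sum_le_sum fun k _ => ?_
    rw [← Finset.mul_sum]
    exact mul_le_of_le_one_right (mul_self_nonneg _) (sum_sum_normSq_le_one hP hsum k)
  have hcol : ∑ k, ∑ l, u l * u l * m k l ≤ 1 := by
    rw [Finset.sum_comm]
    simpa only [hm] using hrow
  rw [hsumm] at hδ ⊢
  have hterm (k l : ι) : geomSubMin u k l * m k l ≤
      (1 / (4 * θ) + θ / 4) * (u k * u k * m k l) + (1 / (4 * θ) + θ / 4) * (u l * u l * m k l) +
        (θ / 2 - 1 / (2 * θ)) * (u k * u l * m k l) := by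
    refine (mul_le_mul_of_nonneg_right (geomSubMin_le hu hθ k l) (hm0 k l)).trans (le_of_eq ?_)
    field_simp
    ring
  have hgeom : ∑ k, ∑ l, u k * u l * m k l ≤ 1 := by
    have : ∑ k, ∑ l, u k * u l * m k l ≤
        ∑ k, ∑ l, ((1 / 2) * (u k * u k * m k l) + (1 / 2) * (u l * u l * m k l)) :=
      Finset.sum_le_sum fun k _ => Finset.sum_le_sum fun l _ => by
        nlinarith [mul_nonneg (sq_nonneg (u k - u l)) (hm0 k l)]
    simp only [Finset.sum_add_distrib, ← Finset.mul_sum] at this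
    simp only [← Finset.mul_sum] at hrow hcol ⊢
    linarith
  have h := Finset.sum_le_sum fun k (_ : k ∈ Finset.univ) =>
    Finset.sum_le_sum fun l (_ : l ∈ Finset.univ) => hterm k l
  refine h.trans ?_
  simp only [Finset.sum_add_distrib, ← Finset.mul_sum (Finset.univ : Finset ι) _
    (1 / (4 * θ) + θ / 4),
    ← Finset.mul_sum (Finset.univ : Finset ι) _ (θ / 2 - 1 / (2 * θ))]
  set x := ∑ k, ∑ l, u k * u k * m k l
  set y := ∑ k, ∑ l, u l * u l * m k l
  set z := ∑ k, ∑ l, u k * u l * m k l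
  have hq : 0 < 1 / (4 * θ) := by positivity
  have e1 : δ / (2 * θ) = 2 * (1 / (4 * θ)) * δ := by field_simp; ring
  have e2 : 1 / (2 * θ) = 2 * (1 / (4 * θ)) := by field_simp; ring
  rw [e1, e2]
  generalize 1 / (4 * θ) = q at *
  nlinarith [mul_le_mul_of_nonneg_left hrow hq.le, mul_le_mul_of_nonneg_left hcol hq.le,
    mul_le_mul_of_nonneg_left hδ hq.le]

lemma le_sum_weightedTrace_min_self [DecidableEq ι] {u : ι → ℝ} (hu : ∀ k, 0 ≤ u k)
    (hu1 : ∑ k, u k * u k = 1) {P : A → Matrix ι ι ℂ}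
    (hP : ∀ a, (P a).PosSemidef) (hsum : ∑ a, P a = 1) {δ θ : ℝ} (hθ : 0 < θ)
    (hδ : 1 - δ ≤ ∑ a, weightedTrace (fun k l => u k * u l) (P a) (P a)) :
    1 - δ - (δ / (2 * θ) + θ) ≤
      ∑ a, weightedTrace (fun k l => min (u k * u k) (u l * u l)) (P a) (P a) := by
  have := sum_weightedTrace_geomSubMin_le hu hu1 hP hsum hθ hδ
  simp only [geomSubMin, weightedTrace_sub_weight, Finset.sum_sub_distrib] at this
  linarith

lemma le_sum_weightedTrace_min [DecidableEq ι] {u : ι → ℝ} (hu : ∀ k, 0 ≤ u k)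
    (hu1 : ∑ k, u k * u k = 1) {P Y : B → Matrix ι ι ℂ}
    (hP : ∀ b, (P b).PosSemidef) (hPsum : ∑ b, P b = 1)
    (hY : ∀ b, (Y b).PosSemidef) (hYsum : ∑ b, Y b = 1) {ε θ : ℝ} (hθ : 0 < θ)
    (hε : 1 - ε ≤ ∑ b, weightedTrace (fun k l => u k * u l) (P b) (Y b)) :
    1 - ε - (ε / θ + θ) ≤
        ∑ b, weightedTrace (fun k l => min (u k * u k) (u l * u l)) (P b) (Y b) ∧
      1 - 2 * ε ≤ ∑ b, weightedTrace (fun k l => u k * u l) (P b) (P b) ∧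
      1 - 2 * ε ≤ ∑ b, weightedTrace (fun k l => u k * u l) (Y b) (Y b) := by
  have hPP := sub_sum_weightedTrace_self_le hu (fun b => (hP b).1) hY hYsum
  have hYY := sub_sum_weightedTrace_self_le hu (fun b => (hY b).1) hP hPsum
  simp only [weightedTrace_comm (fun k l => mul_comm (u k) (u l)) (Y _) (P _)] at hYY
  rw [hu1] at hPP hYY
  have hPP' : 1 - 2 * ε ≤ ∑ b, weightedTrace (fun k l => u k * u l) (P b) (P b) := by linarith
  have hYY' : 1 - 2 * ε ≤ ∑ b, weightedTrace (fun k l => u k * u l) (Y b) (Y b) := by linarith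
  refine ⟨?_, hPP', hYY'⟩
  have h1 := sum_weightedTrace_geomSubMin_le hu hu1 hP hPsum hθ hPP'
  have h2 := sum_weightedTrace_geomSubMin_le hu hu1 hY hYsum hθ hYY'
  have h0 : 0 ≤ ∑ b, weightedTrace (geomSubMin u) (P b - Y b) (P b - Y b) :=
    Finset.sum_nonneg fun b _ =>
      weightedTrace_self_nonneg (geomSubMin_nonneg hu) ((hP b).1.sub (hY b).1)
  simp only [weightedTrace_sub_self (geomSubMin_comm u), Finset.sum_sub_distrib,
    Finset.sum_add_distrib, ← Finset.mul_sum] at h0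
  have h3 : ∑ b, weightedTrace (geomSubMin u) (P b) (Y b) =
      ∑ b, weightedTrace (fun k l => u k * u l) (P b) (Y b) -
        ∑ b, weightedTrace (fun k l => min (u k * u k) (u l * u l)) (P b) (Y b) := by
    simp only [geomSubMin, weightedTrace_sub_weight, Finset.sum_sub_distrib]
  have e : 2 * ε / (2 * θ) = ε / θ := mul_div_mul_left _ _ two_ne_zero
  rw [e] at h1 h2
  linarith

end WeightChange

section SingularValues

variable {ι κ : Type*} [Fintype ι] [DecidableEq ι] [Fintype κ]

/-- The singular value decomposition restricted to the nonzero singular values. -/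
lemma exists_eq_mul_diagonal_mul (K : Matrix ι κ ℂ) :
    ∃ (S : Finset ι) (u : S → ℝ) (U : Matrix ι S ℂ) (W : Matrix S κ ℂ), (∀ k, 0 < u k) ∧
      Uᴴ * U = 1 ∧ W * Wᴴ = 1 ∧ K = U * diagonal (fun k => (u k : ℂ)) * W := by
  obtain ⟨V, d, hV, hV', hd, hK⟩ := (posSemidef_self_mul_conjTranspose K).exists_diagonalization
  have hrow (k l : ι) : ((Vᴴ * K) * (Vᴴ * K)ᴴ) k l = diagonal (fun k => (d k : ℂ)) k l := by
    have : (Vᴴ * K) * (Vᴴ * K)ᴴ = (Vᴴ * V) * diagonal (fun k => (d k : ℂ)) * (Vᴴ * V) := by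
      calc (Vᴴ * K) * (Vᴴ * K)ᴴ = Vᴴ * (K * Kᴴ) * V := by
            simp only [conjTranspose_mul, conjTranspose_conjTranspose, Matrix.mul_assoc]
        _ = _ := by
            rw [hK]
            simp only [Matrix.mul_assoc]
    rw [this, hV, Matrix.one_mul, Matrix.mul_one]
  set S : Finset ι := Finset.univ.filter fun k => 0 < d k with hS
  have hpos (k : S) : 0 < d k := (Finset.mem_filter.mp k.2).2
  have hsqrt (k : S) : (Real.sqrt (d k) : ℂ) ≠ 0 := by
    exact_mod_cast (Real.sqrt_pos.mpr (hpos k)).ne'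
  refine ⟨S, fun k => Real.sqrt (d k), V.submatrix id (↑),
    of fun k x => (Real.sqrt (d k) : ℂ)⁻¹ * (Vᴴ * K) k x, fun k => Real.sqrt_pos.mpr (hpos k),
    ?_, ?_, ?_⟩
  · ext k l
    have := congrFun (congrFun hV k) l
    rw [one_apply] at this ⊢
    simp only [Subtype.ext_iff]
    exact this
  · ext k l
    have h := hrow k l
    rw [mul_apply, diagonal_apply] at h
    simp only [mul_apply (N := conjTranspose _), conjTranspose_apply, of_apply, star_mul',
      mul_mul_mul_comm _ _ (star _)]
    rw [← Finset.mul_sum]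
    simp only [conjTranspose_apply] at h
    rw [h, one_apply]
    by_cases hkl : k = l
    · subst hkl
      have h2 : (d k : ℂ) = Real.sqrt (d k) * Real.sqrt (d k) := by
        exact_mod_cast (Real.mul_self_sqrt (hd k)).symm
      rw [if_pos rfl, if_pos rfl, h2]
      have := hsqrt k
      simp
      field_simp
    · simp [hkl, Subtype.ext_iff.not.mp hkl]
  · have hzero (k : ι) (hk : k ∉ S) (x : κ) : (Vᴴ * K) k x = 0 := by
      have hdk : d k = 0 := le_antisymm (by simpa [hS] using hk) (hd k)
      have h := congrArg Complex.re (hrow k k)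
      rw [diagonal_apply_eq, hdk, mul_apply, Complex.re_sum] at h
      have h' : ∑ x, Complex.normSq ((Vᴴ * K) k x) = 0 := by
        rw [← Complex.ofReal_re 0, ← h]
        refine Finset.sum_congr rfl fun x _ => ?_
        simp [Complex.normSq_apply]
      exact Complex.normSq_eq_zero.mp
        ((Finset.sum_eq_zero_iff_of_nonneg fun x _ => Complex.normSq_nonneg _).mp h' x
          (Finset.mem_univ x))
    have hVK : K = V * (Vᴴ * K) := by rw [← Matrix.mul_assoc, hV', Matrix.one_mul]
    ext i x
    conv_lhs => rw [hVK]
    rw [mul_apply, mul_apply]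
    simp only [mul_diagonal, submatrix_apply, id, of_apply]
    have : ∀ k : S, V i k * (Real.sqrt (d k) : ℂ) * ((Real.sqrt (d k) : ℂ)⁻¹ * (Vᴴ * K) k x) =
        V i k * (Vᴴ * K) k x := fun k => by
      rw [mul_assoc, mul_inv_cancel_left₀ (hsqrt k)]
    rw [Finset.sum_congr rfl fun k _ => this k,
      Finset.sum_coe_sort S fun k => V i k * (Vᴴ * K) k x]
    refine (Finset.sum_subset (Finset.subset_univ S) fun k _ hk => ?_).symm
    rw [hzero k hk, mul_zero]

lemma star_dotProduct_kronecker_mulVec (P : Matrix ι ι ℂ) (Q : Matrix κ κ ℂ) (ψ : ι × κ → ℂ) :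
    star ψ ⬝ᵥ ((P ⊗ₖ Q) *ᵥ ψ) =
      (P * (of fun k x => ψ (k, x)) * Qᵀ * (of fun k x => ψ (k, x))ᴴ).trace := by
  simp only [dotProduct, mulVec, Fintype.sum_prod_type, kroneckerMap_apply, trace, diag,
    mul_apply, of_apply, conjTranspose_apply, transpose_apply, Pi.star_apply, Finset.mul_sum,
    Finset.sum_mul]
  refine Finset.sum_congr rfl fun k _ => Finset.sum_congr rfl fun x _ => ?_
  rw [Finset.sum_comm]
  refine Finset.sum_congr rfl fun y _ => Finset.sum_congr rfl fun l _ => ?_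
  ring

/-- A bipartite pure-state correlation, expressed on the support of its Schmidt decomposition. -/
lemma exists_weightedTrace_eq_dotProduct [DecidableEq κ] {ψ : ι × κ → ℂ} (hψ : star ψ ⬝ᵥ ψ = 1) :
    ∃ (S : Finset ι) (u : S → ℝ) (U : Matrix ι S ℂ) (W : Matrix S κ ℂ), (∀ k, 0 < u k) ∧
      ∑ k, u k * u k = 1 ∧ Uᴴ * U = 1 ∧ W * Wᴴ = 1 ∧ ∀ P Q,
        (star ψ ⬝ᵥ ((P ⊗ₖ Q) *ᵥ ψ)).re =
          weightedTrace (fun k l => u k * u l) (Uᴴ * P * U) (W * Qᵀ * Wᴴ) := by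
  obtain ⟨S, u, U, W, hu, hU, hW, hK⟩ :=
    exists_eq_mul_diagonal_mul (of fun k x => ψ (k, x) : Matrix ι κ ℂ)
  have hcorr (P : Matrix ι ι ℂ) (Q : Matrix κ κ ℂ) : (star ψ ⬝ᵥ ((P ⊗ₖ Q) *ᵥ ψ)).re =
      weightedTrace (fun k l => u k * u l) (Uᴴ * P * U) (W * Qᵀ * Wᴴ) := by
    have hstar : star (fun k => (u k : ℂ)) = fun k => (u k : ℂ) := by
      ext k
      simp
    rw [star_dotProduct_kronecker_mulVec, hK, weightedTrace_mul_eq_trace]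
    congr 1
    set D := diagonal fun k => (u k : ℂ) with hD
    have hDD : Dᴴ = D := by rw [hD, diagonal_conjTranspose, hstar]
    calc (P * (U * D * W) * Qᵀ * (U * D * W)ᴴ).trace
        = ((P * U * D * W * Qᵀ * Wᴴ) * (D * Uᴴ)).trace := by
          simp only [conjTranspose_mul, hDD, Matrix.mul_assoc]
      _ = ((D * Uᴴ) * (P * U * D * W * Qᵀ * Wᴴ)).trace := trace_mul_comm _ _
      _ = (D * (Uᴴ * P * U) * D * (W * Qᵀ * Wᴴ)).trace := by
          simp only [Matrix.mul_assoc]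
  refine ⟨S, u, U, W, hu, ?_, hU, hW, hcorr⟩
  have h1 := hcorr 1 1
  rw [Matrix.mul_one, hU, transpose_one, Matrix.mul_one, hW, weightedTrace_one_one,
    one_kronecker_one, one_mulVec, hψ] at h1
  exact h1.symm

end SingularValues

end Matrix

lemma exists_finset_of_le_map_min {ι : Type*} [Fintype ι] [DecidableEq ι]
    (F : (ι → ι → ℝ) →ₗ[ℝ] ℝ) (b : ℝ)
    (v : ι → ℝ) (hv : ∀ k, 0 ≤ v k) (hv1 : ∑ k, v k = 1)
    (h : b ≤ F fun k l => min (v k) (v l)) :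
    ∃ S : Finset ι, S.Nonempty ∧ b * S.card ≤ F fun k l => if k ∈ S ∧ l ∈ S then 1 else 0 := by
  have hF (w : ι → ι → ℝ) : F w = ∑ k, ∑ l, F (Pi.single k (Pi.single l 1)) * w k l := by
    have hw : w = ∑ k, ∑ l, w k l • Pi.single k (Pi.single l (1 : ℝ)) := by
      ext k l
      simp only [Finset.sum_apply, Pi.smul_apply, smul_eq_mul]
      rw [Finset.sum_eq_single k, Finset.sum_eq_single l]
      · simp
      · intro l' _ hl
        simp [hl.symm]
      · simp
      · intro k' _ hk
        simp [hk.symm]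
      · simp
    conv_lhs => rw [hw]
    simp only [map_sum, map_smul, smul_eq_mul, mul_comm]
  have hv0 : v ≠ 0 := by
    rintro rfl
    simp at hv1
  obtain ⟨S, hS, hle⟩ := exists_finset_of_le_sum_mul_min
    (fun k l => F (Pi.single k (Pi.single l 1))) b v hv hv0 (by rwa [hv1, mul_one, ← hF])
  refine ⟨S, hS, hle.trans (le_of_eq ?_)⟩
  rw [hF]
  simp only [mul_ite, mul_one, mul_zero, ite_and, Finset.sum_ite_irrel, Finset.sum_ite_mem,
    Finset.univ_inter, Finset.sum_const_zero]

lemma sub_two_mul_sqrt_le {x y E f : ℝ} (hy : 0 ≤ y) (hE : 0 ≤ E)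
    (h : ∀ θ > 0, x - y * (E / θ + θ) ≤ f) : x - 2 * y * √E ≤ f := by
  rcases hE.eq_or_lt with rfl | hE
  · rw [Real.sqrt_zero, mul_zero, sub_zero]
    refine le_of_forall_pos_le_add fun η hη => ?_
    have hy1 : 0 < y + 1 := by linarith
    have := h (η / (y + 1)) (by positivity)
    rw [zero_div, zero_add, mul_div_assoc'] at this
    have h2 : y * η / (y + 1) ≤ η := by
      rw [div_le_iff₀ hy1]
      nlinarith
    linarith
  · have := h (√E) (Real.sqrt_pos.mpr hE)
    rw [Real.div_sqrt] at this
    linarith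

namespace Matrix

section Game

variable {I J : Type*} [Fintype I] [Fintype J] {A : I → Type*} [∀ i, Fintype (A i)]
  {B : J → Type*} [∀ j, Fintype (B j)] {ι : Type*} [Fintype ι] [DecidableEq ι]

lemma weightedTrace_indicator {κ : Type*} [Fintype κ] (S : Finset ι) (e : κ ≃ S)
    (X Y : Matrix ι ι ℂ) :
    weightedTrace (fun k l => if k ∈ S ∧ l ∈ S then 1 else 0) X Y =
      (X.submatrix (fun k => (e k : ι)) (fun k => (e k : ι)) *
        Y.submatrix (fun k => (e k : ι)) (fun k => (e k : ι))).trace.re := by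
  simp only [weightedTrace_apply, ite_mul, one_mul, zero_mul, ite_and, Finset.sum_ite_irrel,
    Finset.sum_ite_mem, Finset.univ_inter, Finset.sum_const_zero, trace, diag, mul_apply,
    submatrix_apply, Complex.re_sum]
  rw [← Finset.sum_coe_sort S, ← e.sum_comp]
  refine Finset.sum_congr rfl fun k _ => ?_
  rw [← Finset.sum_coe_sort S, ← e.sum_comp]

lemma sum_submatrix_eq_one {κ A : Type*} [DecidableEq κ] [Fintype A] {P : A → Matrix ι ι ℂ}
    (hsum : ∑ a, P a = 1) {g : κ → ι} (hg : Function.Injective g) :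
    ∑ a, (P a).submatrix g g = 1 := by
  rw [← submatrix_one g hg, ← hsum]
  ext k l
  simp [sum_apply]

/-- For an almost perfect strategy of a non-degenerate projection game in a weighted trace, some
spectral projection of the weight is almost preserved by all measurements. -/
lemma exists_finset_le_sum_weightedTrace {μ : I → J → ℝ} (hμ0 : ∀ i j, 0 ≤ μ i j)
    (hμ1 : ∑ i, ∑ j, μ i j = 1) {p : ∀ i j, A i → B j}
    (hnd : ∀ i (a a' : A i), (∀ j, 0 < μ i j → p i j a = p i j a') → a = a')
    {L : ℝ} (hL1 : 1 ≤ L) (hL : ∀ i j, 0 < μ i j → ∑ j', μ i j' ≤ L * μ i j)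
    {u : ι → ℝ} (hu : ∀ k, 0 ≤ u k) (hu1 : ∑ k, u k * u k = 1)
    {P : ∀ i, A i → Matrix ι ι ℂ} {Y : ∀ j, B j → Matrix ι ι ℂ}
    (hP : ∀ i a, (P i a).PosSemidef) (hPsum : ∀ i, ∑ a, P i a = 1)
    (hY : ∀ j b, (Y j b).PosSemidef) (hYsum : ∀ j, ∑ b, Y j b = 1) {ε : ℝ}
    (hw : 1 - ε ≤ ∑ i, ∑ j, μ i j *
      ∑ a, weightedTrace (fun k l => u k * u l) (P i a) (Y j (p i j a))) :
    ∃ S : Finset ι, S.Nonempty ∧ (33 - (65 * (L * ε) + 66 * √(L * ε))) * S.card ≤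
      ∑ i, ∑ j, μ i j *
        (16 * ∑ a, weightedTrace (fun k l => if k ∈ S ∧ l ∈ S then 1 else 0) (P i a) (P i a) +
        16 * ∑ b, weightedTrace (fun k l => if k ∈ S ∧ l ∈ S then 1 else 0) (Y j b) (Y j b) +
        ∑ a, weightedTrace (fun k l => if k ∈ S ∧ l ∈ S then 1 else 0) (P i a)
          (Y j (p i j a))) := by
  classical
  let F : (ι → ι → ℝ) →ₗ[ℝ] ℝ := ∑ i, ∑ j, μ i j •
    ((16 : ℝ) • ∑ a, weightedTraceOfWeight (P i a) (P i a) +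
      (16 : ℝ) • ∑ b, weightedTraceOfWeight (Y j b) (Y j b) +
        ∑ a, weightedTraceOfWeight (P i a) (Y j (p i j a)))
  have hF (w : ι → ι → ℝ) : F w = ∑ i, ∑ j, μ i j *
        (16 * ∑ a, weightedTrace w (P i a) (P i a) + 16 * ∑ b, weightedTrace w (Y j b) (Y j b) +
        ∑ a, weightedTrace w (P i a) (Y j (p i j a))) := by
    simp only [F, LinearMap.sum_apply, LinearMap.smul_apply, LinearMap.add_apply, smul_eq_mul,
      weightedTraceOfWeight_apply]
  simp only [← hF]
  refine exists_finset_of_le_map_min F _ (fun k => u k * u k) (fun k => mul_self_nonneg _) hu1 ?_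
  let e : I → J → ℝ := fun i j =>
    1 - ∑ a, weightedTrace (fun k l => u k * u l) (P i a) (Y j (p i j a))
  have hfib (i : I) (j : J) (θ : ℝ) (hθ : 0 < θ) :=
    le_sum_weightedTrace_min hu hu1 (posSemidef_sum_fiber (p i j) (hP i))
      (sum_sum_fiber (p i j) (hPsum i)) (hY j) (hYsum j) hθ (ε := e i j)
      (by rw [← sum_weightedTrace_comp _ (p i j) (P i) (Y j)]; simp [e])
  have he (i : I) (j : J) : 0 ≤ e i j := by
    have h1 := (hfib i j 1 one_pos).2.2
    have h2 := sum_weightedTrace_self_le u (hY j) (hYsum j)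
    linarith
  have hμe : ∑ i, ∑ j, μ i j * e i j ≤ ε := by
    simp only [e, mul_sub, Finset.sum_sub_distrib, mul_one, hμ1]
    linarith
  have hμe0 : 0 ≤ ∑ i, ∑ j, μ i j * e i j :=
    Finset.sum_nonneg fun i _ => Finset.sum_nonneg fun j _ => mul_nonneg (hμ0 i j) (he i j)
  have hεL : ε ≤ L * ε := le_mul_of_one_le_left (hμe0.trans hμe) hL1
  let T : I → Finset J := fun i => Finset.univ.filter fun j => 0 < μ i j
  let δ : I → ℝ := fun i => ∑ j ∈ T i, 2 * e i j
  have hδ (i : I) :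
      1 - δ i ≤ ∑ a, weightedTrace (fun k l => u k * u l) (P i a) (P i a) := by
    have h := sub_sum_weightedTrace_self_le_sum u (hP i) (hPsum i) (T i) (p i)
      (fun a a' haa' => hnd i a a' fun j hj => haa' j (by simpa [T] using hj))
    rw [hu1] at h
    have h' : ∑ j ∈ T i, (1 - ∑ b, weightedTrace (fun k l => u k * u l)
        (∑ a with p i j a = b, P i a) (∑ a with p i j a = b, P i a)) ≤ δ i :=
      Finset.sum_le_sum fun j _ => by linarith [(hfib i j 1 one_pos).2.1]
    linarith
  have hμδ : ∑ i, ∑ j, μ i j * δ i ≤ 2 * (L * ε) := by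
    calc ∑ i, ∑ j, μ i j * δ i ≤ ∑ i, ∑ j, 2 * L * (μ i j * e i j) := by
          refine Finset.sum_le_sum fun i _ => ?_
          rw [← Finset.sum_mul, Finset.mul_sum]
          calc ∑ j ∈ T i, (∑ j', μ i j') * (2 * e i j)
              ≤ ∑ j ∈ T i, 2 * L * (μ i j * e i j) := Finset.sum_le_sum fun j hj => by
                have := mul_le_mul_of_nonneg_right (hL i j (by simpa [T] using hj)) (he i j)
                linarith
            _ ≤ _ := Finset.sum_le_univ_sum_of_nonneg fun j => by
                have := mul_nonneg (hμ0 i j) (he i j)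
                positivity
      _ = 2 * L * ∑ i, ∑ j, μ i j * e i j := by simp only [Finset.mul_sum]
      _ ≤ 2 * L * ε := by gcongr
      _ = _ := by ring
  rw [show 33 - (65 * (L * ε) + 66 * √(L * ε)) =
    33 - 65 * (L * ε) - 2 * 33 * √(L * ε) by ring]
  refine sub_two_mul_sqrt_le (by norm_num) (hμe0.trans (hμe.trans hεL)) fun θ hθ => ?_
  have hterm (i : I) (j : J) :
      (33 - 33 * θ) * μ i j - (16 + 8 / θ) * (μ i j * δ i) - (33 + 17 / θ) * (μ i j * e i j) ≤
      μ i j * (16 * ∑ a, weightedTrace (fun k l => min (u k * u k) (u l * u l)) (P i a) (P i a) +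
        16 * ∑ b, weightedTrace (fun k l => min (u k * u k) (u l * u l)) (Y j b) (Y j b) +
        ∑ a, weightedTrace (fun k l => min (u k * u k) (u l * u l)) (P i a)
          (Y j (p i j a))) := by
    have h1 := le_sum_weightedTrace_min_self hu hu1 (hP i) (hPsum i) hθ (hδ i)
    have h2 := le_sum_weightedTrace_min_self hu hu1 (hY j) (hYsum j) hθ (hfib i j 1 one_pos).2.2
    have h3 := (hfib i j θ hθ).1
    rw [← sum_weightedTrace_comp _ (p i j) (P i) (Y j)] at h3
    have h4 : (33 - 33 * θ) * μ i j - (16 + 8 / θ) * (μ i j * δ i) -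
        (33 + 17 / θ) * (μ i j * e i j) = μ i j * (16 * (1 - δ i - (δ i / (2 * θ) + θ)) +
          16 * (1 - 2 * e i j - (2 * e i j / (2 * θ) + θ)) +
          (1 - e i j - (e i j / θ + θ))) := by
      field_simp
      ring
    rw [h4]
    refine mul_le_mul_of_nonneg_left ?_ (hμ0 i j)
    linarith
  have hsum := Finset.sum_le_sum fun i (_ : i ∈ Finset.univ) =>
    Finset.sum_le_sum fun j (_ : j ∈ Finset.univ) => hterm i j
  rw [hF]
  refine le_trans ?_ hsum
  simp only [Finset.sum_sub_distrib, ← Finset.mul_sum _ _ (33 - 33 * θ),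
    ← Finset.mul_sum _ _ (16 + 8 / θ), ← Finset.mul_sum _ _ (33 + 17 / θ), hμ1]
  have hq : 0 < 1 / θ := by positivity
  rw [div_eq_mul_one_div (L * ε), div_eq_mul_one_div 8, div_eq_mul_one_div 17]
  have h5 := mul_le_mul_of_nonneg_left hμδ (show 0 ≤ 16 + 8 * (1 / θ) by positivity)
  have h6 := mul_le_mul_of_nonneg_left (hμe.trans hεL) (show 0 ≤ 33 + 17 * (1 / θ) by positivity)
  nlinarith

/-- An almost perfect strategy of a non-degenerate projection game in a weighted trace is close to
a strategy of projective measurements with respect to the normalized trace of a matrix algebra. -/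
lemma exists_pvm_strategy [∀ i, Nonempty (A i)] [∀ j, Nonempty (B j)]
    {μ : I → J → ℝ} (hμ0 : ∀ i j, 0 ≤ μ i j)
    (hμ1 : ∑ i, ∑ j, μ i j = 1) {p : ∀ i j, A i → B j}
    (hnd : ∀ i (a a' : A i), (∀ j, 0 < μ i j → p i j a = p i j a') → a = a')
    {L : ℝ} (hL1 : 1 ≤ L) (hL : ∀ i j, 0 < μ i j → ∑ j', μ i j' ≤ L * μ i j)
    {u : ι → ℝ} (hu : ∀ k, 0 ≤ u k) (hu1 : ∑ k, u k * u k = 1)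
    {P : ∀ i, A i → Matrix ι ι ℂ} {Y : ∀ j, B j → Matrix ι ι ℂ}
    (hP : ∀ i a, (P i a).PosSemidef) (hPsum : ∀ i, ∑ a, P i a = 1)
    (hY : ∀ j b, (Y j b).PosSemidef) (hYsum : ∀ j, ∑ b, Y j b = 1) {ε : ℝ}
    (hw : 1 - ε ≤ ∑ i, ∑ j, μ i j *
      ∑ a, weightedTrace (fun k l => u k * u l) (P i a) (Y j (p i j a))) :
    ∃ (n : ℕ) (r : ∀ i, A i → Matrix (Fin n) (Fin n) ℂ)
      (s : ∀ j, B j → Matrix (Fin n) (Fin n) ℂ), 1 ≤ n ∧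
      (∀ i a, (r i a).IsHermitian ∧ r i a * r i a = r i a) ∧ (∀ i, ∑ a, r i a = 1) ∧
      (∀ j b, (s j b).IsHermitian ∧ s j b * s j b = s j b) ∧ (∀ j, ∑ b, s j b = 1) ∧
      (1 - 3 * (65 * (L * ε) + 66 * √(L * ε))) * n ≤
        ∑ i, ∑ j, μ i j * ∑ a, (r i a * s j (p i j a)).trace.re := by
  classical
  obtain ⟨S, hSne, hS⟩ :=
    exists_finset_le_sum_weightedTrace hμ0 hμ1 hnd hL1 hL hu hu1 hP hPsum hY hYsum hw
  let e : Fin S.card ≃ S := S.equivFin.symm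
  simp only [weightedTrace_indicator S e] at hS
  let P' : ∀ i, A i → Matrix (Fin S.card) (Fin S.card) ℂ := fun i a =>
    (P i a).submatrix (fun k => (e k : ι)) fun k => (e k : ι)
  let Y' : ∀ j, B j → Matrix (Fin S.card) (Fin S.card) ℂ := fun j b =>
    (Y j b).submatrix (fun k => (e k : ι)) fun k => (e k : ι)
  have hinj : Function.Injective fun k => (e k : ι) := Subtype.val_injective.comp e.injective
  have hP' i a : (P' i a).PosSemidef := (hP i a).submatrix _
  have hY' j b : (Y' j b).PosSemidef := (hY j b).submatrix _
  choose r hr hrsum hrP using fun i => exists_pvm_near_povm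
      (P' i) (hP' i) (sum_submatrix_eq_one (hPsum i) hinj)
  choose s hs hssum hsY using fun j => exists_pvm_near_povm
      (Y' j) (hY' j) (sum_submatrix_eq_one (hYsum j) hinj)
  refine ⟨S.card, r, s, Finset.card_pos.mpr hSne, hr, hrsum, hs, hssum, ?_⟩
  have hterm (i : I) (j : J) : μ i j * S.card - 3 * (33 * (μ i j * S.card) - μ i j *
      (16 * ∑ a, (P' i a * P' i a).trace.re + 16 * ∑ b, (Y' j b * Y' j b).trace.re +
        ∑ a, (P' i a * Y' j (p i j a)).trace.re)) ≤
      μ i j * ∑ a, (r i a * s j (p i j a)).trace.re := by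
    have h1 := card_sub_sum_trace_le (p i j) (hP' i) (sum_submatrix_eq_one (hPsum i) hinj)
        (hY' j) (sum_submatrix_eq_one (hYsum j) hinj)
      (hr i) (hrsum i) (hs j) (hssum j)
    have h2 := hrP i
    have h3 := hsY j
    simp only [Fintype.card_fin] at h1 h2 h3
    have h4 := mul_le_mul_of_nonneg_left (show S.card - 3 * (33 * S.card -
      (16 * ∑ a, (P' i a * P' i a).trace.re + 16 * ∑ b, (Y' j b * Y' j b).trace.re +
        ∑ a, (P' i a * Y' j (p i j a)).trace.re)) ≤
      ∑ a, (r i a * s j (p i j a)).trace.re by linarith) (hμ0 i j)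
    linarith
  have hsum := Finset.sum_le_sum fun i (_ : i ∈ Finset.univ) =>
    Finset.sum_le_sum fun j (_ : j ∈ Finset.univ) => hterm i j
  refine le_trans ?_ hsum
  simp only [Finset.sum_sub_distrib, ← Finset.mul_sum _ _ (3 : ℝ), ← Finset.mul_sum _ _ (33 : ℝ),
    ← Finset.sum_mul, hμ1]
  linarith

end Game

end Matrix

lemma one_sub_le_of_error {x : ℝ} (hx : 0 ≤ x) {v : ℝ} (hv : 0 ≤ v)
    (h : 1 - 3 * (65 * x ^ 4 + 66 * x ^ 2) ≤ v) : 1 - 148 * x ≤ v := by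
  by_cases hx1 : 1 ≤ 148 * x
  · linarith
  · have h1 : x ≤ 1 / 148 := by linarith
    have h2 : x ^ 2 ≤ x * (1 / 148) := by nlinarith
    have h4 : x ^ 4 ≤ x ^ 2 := by nlinarith [sq_nonneg x]
    linarith

lemma Real.rpow_one_div_four_pow_four {E : ℝ} (hE : 0 ≤ E) : (E ^ ((1 : ℝ) / 4)) ^ 4 = E := by
  rw [← Real.rpow_natCast, ← Real.rpow_mul hE]
  norm_num

lemma Real.rpow_one_div_four_sq {E : ℝ} (hE : 0 ≤ E) : (E ^ ((1 : ℝ) / 4)) ^ 2 = √E := by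
  rw [Real.sqrt_eq_rpow, ← Real.rpow_natCast, ← Real.rpow_mul hE]
  norm_num

/-- Let `G` be a non-degenerate projection game and `c` a quantum
correlation with `w_G(c) ≥ 1 - ε`.  With `L = max_{(i,j) : μ(i,j)>0} μ(i)/μ(i,j)`, there
is a finite-dimensional tracial correlation `c'` (PVMs of projections in `Mₙ(ℂ)` and a
density matrix tracial on the generated unital *-subalgebra) with
`w_G(c') ≥ 1 - 148 (L ε)^{1/4}`. -/
theorem almost_perfect_quantum_strategy_near_tracial
    {I J : Type} [Fintype I] [Fintype J] [Nonempty I] [Nonempty J]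
    {A : I → Type} [∀ i, Fintype (A i)] [∀ i, Nonempty (A i)]
    {B : J → Type} [∀ j, Fintype (B j)] [∀ j, Nonempty (B j)]
    (μ : I → J → ℝ) (hμ0 : ∀ i j, 0 ≤ μ i j) (hμ1 : ∑ i, ∑ j, μ i j = 1)
    (p : ∀ i j, A i → B j)
    -- non-degeneracy
    (hnd : ∀ i (a a' : A i), (∀ j, 0 < μ i j → p i j a = p i j a') → a = a')
    -- `L` is the maximum of `μ(i)/μ(i,j)` over pairs with `μ(i,j) > 0`
    (L : ℝ)
    (hL : IsGreatest {x : ℝ | ∃ i j, 0 < μ i j ∧ x = (∑ j', μ i j') / μ i j} L)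
    -- `c` is a quantum correlation
    {dA dB : ℕ}
    (P : ∀ i, A i → Matrix (Fin dA) (Fin dA) ℂ)
    (Q : ∀ j, B j → Matrix (Fin dB) (Fin dB) ℂ)
    (hP : ∀ i a, (P i a).PosSemidef) (hPsum : ∀ i, ∑ a, P i a = 1)
    (hQ : ∀ j b, (Q j b).PosSemidef) (hQsum : ∀ j, ∑ b, Q j b = 1)
    (ψ : Fin dA × Fin dB → ℂ) (hψ : star ψ ⬝ᵥ ψ = 1)
    (c : ∀ i j, A i → B j → ℝ)
    (hc : ∀ i j a b, (c i j a b : ℂ) = star ψ ⬝ᵥ ((P i a ⊗ₖ Q j b) *ᵥ ψ))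
    -- the strategy wins with probability at least `1 - ε`
    (ε : ℝ)
    (hw : 1 - ε ≤ ∑ i, ∑ j, μ i j * ∑ a, c i j a (p i j a)) :
    ∃ (n : ℕ) (r : ∀ i, A i → Matrix (Fin n) (Fin n) ℂ)
      (s : ∀ j, B j → Matrix (Fin n) (Fin n) ℂ) (σ : Matrix (Fin n) (Fin n) ℂ)
      (c' : ∀ i j, A i → B j → ℝ),
      1 ≤ n ∧
      (∀ i a, (r i a).IsHermitian ∧ r i a * r i a = r i a) ∧ (∀ i, ∑ a, r i a = 1) ∧
      (∀ j b, (s j b).IsHermitian ∧ s j b * s j b = s j b) ∧ (∀ j, ∑ b, s j b = 1) ∧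
      σ.PosSemidef ∧ σ.trace = 1 ∧
      (∀ x y : Matrix (Fin n) (Fin n) ℂ,
        x ∈ StarAlgebra.adjoin ℂ
          ({M | ∃ i a, M = r i a} ∪ {M | ∃ j b, M = s j b}) →
        y ∈ StarAlgebra.adjoin ℂ
          ({M | ∃ i a, M = r i a} ∪ {M | ∃ j b, M = s j b}) →
        (σ * (x * y)).trace = (σ * (y * x)).trace) ∧
      (∀ i j a b, (c' i j a b : ℂ) = (σ * (r i a * s j b)).trace) ∧
      1 - 148 * (L * ε) ^ ((1 : ℝ)/4)
        ≤ ∑ i, ∑ j, μ i j * ∑ a, c' i j a (p i j a) := by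
  have hL1 : 1 ≤ L := by
    obtain ⟨i, j, hij, rfl⟩ := hL.1
    rw [one_le_div hij]
    exact Finset.single_le_sum (fun j' _ => hμ0 i j') (Finset.mem_univ j)
  have hLle (i : I) (j : J) (hij : 0 < μ i j) : ∑ j', μ i j' ≤ L * μ i j :=
    (div_le_iff₀ hij).mp (hL.2 ⟨i, j, hij, rfl⟩)
  obtain ⟨S, u, U, W, hu, hu1, hU, hW, hcorr⟩ := Matrix.exists_weightedTrace_eq_dotProduct hψ
  have hcre i j a b : c i j a b =
      Matrix.weightedTrace (fun k l => u k * u l) (Uᴴ * P i a * U) (W * (Q j b)ᵀ * Wᴴ) := by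
    rw [← hcorr, ← hc, Complex.ofReal_re]
  simp only [hcre] at hw
  have hP' i a : (Uᴴ * P i a * U).PosSemidef := (hP i a).conjTranspose_mul_mul_same U
  have hPsum' i : ∑ a, Uᴴ * P i a * U = 1 := by
    rw [← Matrix.sum_mul, ← Matrix.mul_sum, hPsum, Matrix.mul_one, hU]
  have hQ' j b : (W * (Q j b)ᵀ * Wᴴ).PosSemidef := (hQ j b).transpose.mul_mul_conjTranspose_same W
  have hQsum' j : ∑ b, W * (Q j b)ᵀ * Wᴴ = 1 := by
    rw [← Matrix.sum_mul, ← Matrix.mul_sum, ← Matrix.transpose_sum, hQsum, Matrix.transpose_one,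
      Matrix.mul_one, hW]
  have hε : 0 ≤ ε := by
    have hle i j : ∑ a, Matrix.weightedTrace (fun k l => u k * u l) (Uᴴ * P i a * U)
        (W * (Q j (p i j a))ᵀ * Wᴴ) ≤ 1 := by
      classical
      have h1 := Matrix.sub_sum_weightedTrace_self_le (fun k => (hu k).le)
        (fun b => (Matrix.posSemidef_sum_fiber (p i j) (hP' i) b).1) (hQ' j) (hQsum' j)
      have h2 := Matrix.sum_weightedTrace_self_le u (Matrix.posSemidef_sum_fiber (p i j) (hP' i))
        (Matrix.sum_sum_fiber (p i j) (hPsum' i))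
      rw [hu1] at h1 h2
      rw [Matrix.sum_weightedTrace_comp _ (p i j) (fun a => Uᴴ * P i a * U)
        fun b => W * (Q j b)ᵀ * Wᴴ]
      linarith
    have := Finset.sum_le_sum fun i (_ : i ∈ Finset.univ) =>
      Finset.sum_le_sum fun j (_ : j ∈ Finset.univ) =>
        mul_le_mul_of_nonneg_left (hle i j) (hμ0 i j)
    simp only [mul_one, hμ1] at this
    linarith
  have hE : 0 ≤ L * ε := mul_nonneg (zero_le_one.trans hL1) hε
  obtain ⟨n, r, s, hn, hr, hrsum, hs, hssum, hval⟩ := Matrix.exists_pvm_strategy hμ0 hμ1 hnd hL1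
    hLle (fun k => (hu k).le) hu1 hP' hPsum' hQ' hQsum' hw
  have hn0 : (0 : ℝ) < n := by exact_mod_cast hn
  have hr' i a := Matrix.PosSemidef.of_isHermitian_of_mul_self (hr i a).1 (hr i a).2
  have hs' j b := Matrix.PosSemidef.of_isHermitian_of_mul_self (hs j b).1 (hs j b).2
  have htr i j a b : 0 ≤ (r i a * s j b).trace.re := (hr' i a).trace_mul_nonneg (hs' j b)
  have hreal i j a b : ((r i a * s j b).trace.re : ℂ) = (r i a * s j b).trace := by
    refine Complex.conj_eq_iff_re.mp ?_
    rw [← Matrix.trace_mul_comm (s j b), starRingEnd_apply, ← Matrix.trace_conjTranspose,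
      Matrix.conjTranspose_mul, (hr i a).1.eq, (hs j b).1.eq, Matrix.trace_mul_comm]
  refine ⟨n, r, s, ((n : ℝ)⁻¹ : ℂ) • (1 : Matrix (Fin n) (Fin n) ℂ),
    fun i j a b => (n : ℝ)⁻¹ * (r i a * s j b).trace.re, hn, hr, hrsum, hs, hssum,
      ?_, ?_, ?_, ?_, ?_⟩
  · refine Matrix.PosSemidef.one.smul ?_
    rw [← Complex.ofReal_inv]
    exact_mod_cast (inv_pos.mpr hn0).le
  · rw [Matrix.trace_smul, Matrix.trace_one, Fintype.card_fin, smul_eq_mul]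
    have : (n : ℂ) ≠ 0 := by exact_mod_cast hn0.ne'
    simp [this]
  · intro x y _ _
    rw [smul_mul_assoc, smul_mul_assoc, one_mul, one_mul, Matrix.trace_smul, Matrix.trace_smul,
      Matrix.trace_mul_comm]
  · intro i j a b
    rw [smul_mul_assoc, one_mul, Matrix.trace_smul, smul_eq_mul, Complex.ofReal_mul, hreal,
      Complex.ofReal_inv]
  · have hsum : ∑ i, ∑ j, μ i j * ∑ a, (n : ℝ)⁻¹ * (r i a * s j (p i j a)).trace.re =
        (n : ℝ)⁻¹ * ∑ i, ∑ j, μ i j * ∑ a, (r i a * s j (p i j a)).trace.re := by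
      simp only [Finset.mul_sum, mul_left_comm]
    refine one_sub_le_of_error (Real.rpow_nonneg hE _) ?_ ?_
    · exact Finset.sum_nonneg fun i _ => Finset.sum_nonneg fun j _ => mul_nonneg (hμ0 i j)
        (Finset.sum_nonneg fun a _ => mul_nonneg (inv_pos.mpr hn0).le (htr i j a _))
    · rw [Real.rpow_one_div_four_pow_four hE, Real.rpow_one_div_four_sq hE, hsum,
        ← div_eq_inv_mul, le_div_iff₀ hn0]
      exact hval
end

section
/- Let G = (I, J, {A_i}, {B_j}, μ, V) be an arbitrary (possibly degenerate) projection game, and let c be a quantum correlation for G with w_G(c) ≥ 1 − ε. Let L = max_{(i,j) : μ(i,j)>0} μ(i)/μ(i,j), where μ(i) = Σ_j μ(i,j). Then there exists a finite-dimensional tracial correlation c′ for G — i.e. n ≥ 1, PVMs {r^i_a} and {r^j_b} of orthogonal projections in M_n(ℂ), and a positive semidefinite σ ∈ M_n(ℂ) with Tr(σ) = 1 and Tr(σ x y) = Tr(σ y x) for all x, y in the unital *-subalgebra generated by all these projections, with c′(a,b|i,j) = Tr(σ r^i_a r^j_b) — such that w_G(c′) ≥ 1 − 148(Lε)^{1/4}.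 -/
open scoped ComplexOrder Kronecker Matrix

/-- A finite family of positive semidefinite matrices summing to the identity. -/
def IsPOVM {α k : Type*} [Fintype α] [Fintype k] [DecidableEq k]
    (E : α → Matrix k k ℂ) : Prop :=
  (∀ a, (E a).PosSemidef) ∧ ∑ a, E a = 1

/-- The entrywise weighted real trace form `∑ w k l * Re (X k l * Y l k)`. -/
def wip {k : Type*} [Fintype k] (w : k → k → ℝ) (X Y : Matrix k k ℂ) : ℝ :=
  ∑ i, ∑ j, w i j * (X i j * Y j i).re

/-- The sum of the elements of a POVM over the fibre of `f` above `b`. -/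
def coarsen {α β k : Type*} [Fintype α] [DecidableEq β] (f : α → β)
    (E : α → Matrix k k ℂ) (b : β) : Matrix k k ℂ :=
  ∑ a with f a = b, E a

section Spectral

open Matrix

variable {k : Type*} [Fintype k] [DecidableEq k]

lemma Matrix.PosSemidef.exists_unitary_diagonalization {F : Matrix k k ℂ} (hF : F.PosSemidef) :
    ∃ (V : Matrix k k ℂ) (l : k → ℝ), Vᴴ * V = 1 ∧ V * Vᴴ = 1 ∧ (∀ i, 0 ≤ l i) ∧
      F = V * diagonal (fun i => (l i : ℂ)) * Vᴴ := by
  refine ⟨(hF.1.eigenvectorUnitary : Matrix k k ℂ), hF.1.eigenvalues,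
    mem_unitaryGroup_iff'.mp hF.1.eigenvectorUnitary.2,
    mem_unitaryGroup_iff.mp hF.1.eigenvectorUnitary.2, hF.eigenvalues_nonneg, ?_⟩
  have h := hF.1.spectral_theorem
  rw [Unitary.conjStarAlgAut_apply] at h
  exact h

/-- A positive semidefinite matrix is `W * Wᴴ` for some `W` with orthogonal columns. -/
lemma Matrix.PosSemidef.exists_eq_mul_conjTranspose {F : Matrix k k ℂ} (hF : F.PosSemidef) :
    ∃ (W : Matrix k k ℂ) (l : k → ℝ), F = W * Wᴴ ∧ Wᴴ * W = diagonal fun i => (l i : ℂ) := by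
  obtain ⟨V, l, hV, -, hl, hFV⟩ := hF.exists_unitary_diagonalization
  set D : Matrix k k ℂ := diagonal fun i => ((Real.sqrt (l i) : ℝ) : ℂ) with hD
  have hDh : Dᴴ = D := by
    rw [hD, diagonal_conjTranspose]
    congr 1
    funext m
    exact Complex.conj_ofReal _
  have hDD : D * D = diagonal fun i => (l i : ℂ) := by
    rw [hD, diagonal_mul_diagonal]
    congr 1
    funext m
    rw [← Complex.ofReal_mul, Real.mul_self_sqrt (hl m)]
  refine ⟨V * D, l, ?_, ?_⟩
  · rw [conjTranspose_mul, hDh, Matrix.mul_assoc, ← Matrix.mul_assoc D, hDD, ← Matrix.mul_assoc,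
      hFV]
  · rw [conjTranspose_mul, hDh, Matrix.mul_assoc, ← Matrix.mul_assoc Vᴴ, hV, Matrix.one_mul, hDD]

end Spectral

section Wip

variable {k : Type*}

lemma re_mul_eq_normSq {X : Matrix k k ℂ} (hX : X.IsHermitian) (i j : k) :
    (X i j * X j i).re = Complex.normSq (X i j) := by
  rw [← hX.apply j i, Complex.star_def, Complex.mul_conj, Complex.ofReal_re]

variable [Fintype k]

lemma wip_sum_left {ι : Type*} (w : k → k → ℝ) (S : Finset ι) (X : ι → Matrix k k ℂ)
    (Y : Matrix k k ℂ) : wip w (∑ a ∈ S, X a) Y = ∑ a ∈ S, wip w (X a) Y := by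
  simp only [wip, Matrix.sum_apply, Finset.sum_mul, Complex.re_sum, Finset.mul_sum]
  rw [Finset.sum_comm]
  conv_rhs => rw [Finset.sum_comm]
  rw [Finset.sum_comm]
  exact Finset.sum_congr rfl fun i _ => Finset.sum_comm

lemma wip_sum_right {ι : Type*} (w : k → k → ℝ) (S : Finset ι) (X : Matrix k k ℂ)
    (Y : ι → Matrix k k ℂ) : wip w X (∑ a ∈ S, Y a) = ∑ a ∈ S, wip w X (Y a) := by
  simp only [wip, Matrix.sum_apply, Finset.mul_sum, Complex.re_sum]
  conv_rhs => rw [Finset.sum_comm]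
  exact Finset.sum_congr rfl fun i _ => Finset.sum_comm

lemma wip_self {X : Matrix k k ℂ} (hX : X.IsHermitian) (w : k → k → ℝ) :
    wip w X X = ∑ i, ∑ j, w i j * Complex.normSq (X i j) := by
  simp only [wip, re_mul_eq_normSq hX]

/-- The form `wip w` computes squared distances between Hermitian matrices. -/
lemma sum_normSq_sub {X Y : Matrix k k ℂ} (hX : X.IsHermitian) (hY : Y.IsHermitian)
    (w : k → k → ℝ) :
    ∑ i, ∑ j, w i j * Complex.normSq (X i j - Y i j) =
      wip w X X + wip w Y Y - 2 * wip w X Y := by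
  rw [wip_self hX, wip_self hY, wip]
  simp only [Finset.mul_sum, ← Finset.sum_add_distrib, ← Finset.sum_sub_distrib]
  refine Finset.sum_congr rfl fun i _ => Finset.sum_congr rfl fun j _ => ?_
  rw [← hY.apply j i, Complex.star_def, Complex.normSq_sub]
  ring

lemma two_mul_wip_le {X Y : Matrix k k ℂ} (hX : X.IsHermitian) (hY : Y.IsHermitian)
    {w : k → k → ℝ} (hw : ∀ i j, 0 ≤ w i j) :
    2 * wip w X Y ≤ wip w X X + wip w Y Y := by
  have h := sum_normSq_sub hX hY w
  have h0 : 0 ≤ ∑ i, ∑ j, w i j * Complex.normSq (X i j - Y i j) :=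
    Finset.sum_nonneg fun i _ => Finset.sum_nonneg fun j _ =>
      mul_nonneg (hw i j) (Complex.normSq_nonneg _)
  linarith

lemma wip_mul_eq_trace [DecidableEq k] (s : k → ℝ) (X Y : Matrix k k ℂ) :
    wip (fun i j => s i * s j) X Y =
      (Matrix.diagonal (fun i => (s i : ℂ)) * X * Matrix.diagonal (fun i => (s i : ℂ)) * Y).trace.re := by
  simp only [wip, Matrix.trace, Matrix.diag, Matrix.mul_apply (N := Y), Matrix.mul_diagonal,
    Matrix.diagonal_mul, Complex.re_sum]
  refine Finset.sum_congr rfl fun i _ => Finset.sum_congr rfl fun j _ => ?_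
  rw [← Complex.re_ofReal_mul]
  congr 1
  push_cast
  ring

lemma wip_one_eq_trace (X Y : Matrix k k ℂ) : wip (fun _ _ => 1) X Y = (X * Y).trace.re := by
  simp [wip, Matrix.trace, Matrix.mul_apply]

/-- The trace of a product of positive semidefinite matrices is nonnegative. -/
lemma trace_mul_re_nonneg {X Y : Matrix k k ℂ} (hX : X.PosSemidef) (hY : Y.PosSemidef) :
    0 ≤ (X * Y).trace.re := by
  classical
  obtain ⟨B, -, rfl, -⟩ := hX.exists_eq_mul_conjTranspose
  rw [Matrix.mul_assoc, Matrix.trace_mul_comm]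
  have := (hY.conjTranspose_mul_mul_same B).trace_nonneg
  exact (Complex.nonneg_iff.mp this).1

lemma wip_mul_nonneg (s : k → ℝ) {X Y : Matrix k k ℂ} (hX : X.PosSemidef)
    (hY : Y.PosSemidef) : 0 ≤ wip (fun i j => s i * s j) X Y := by
  classical
  rw [wip_mul_eq_trace]
  refine trace_mul_re_nonneg ?_ hY
  have h := hX.mul_mul_conjTranspose_same (Matrix.diagonal (fun i => (s i : ℂ)))
  rwa [Matrix.diagonal_conjTranspose, show star (fun i => (s i : ℂ)) = fun i => (s i : ℂ) from
    funext fun i => Complex.conj_ofReal _] at h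

/-- An effect `0 ≤ X ≤ 1` satisfies `X ^ 2 ≤ X` on the diagonal. -/
lemma sum_normSq_row_le [DecidableEq k] {X : Matrix k k ℂ} (hX : X.PosSemidef)
    (hX1 : (1 - X).PosSemidef) (i : k) : ∑ j, Complex.normSq (X i j) ≤ (X i i).re := by
  have h1 := hX1.mul_mul_conjTranspose_same X
  have h2 := hX.mul_mul_conjTranspose_same (1 - X)
  rw [hX.1.eq] at h1
  rw [hX1.1.eq] at h2
  have h3 : (X - X * X).PosSemidef := by
    have := h1.add h2
    convert this using 1
    noncomm_ring
  have h4 := (Complex.nonneg_iff.mp (h3.diag_nonneg (i := i))).1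
  rw [Matrix.sub_apply, Matrix.mul_apply, Complex.sub_re, Complex.re_sum] at h4
  simp only [re_mul_eq_normSq hX.1] at h4
  linarith

lemma sum_wip_comp {α β : Type*} [Fintype α] [Fintype β] [DecidableEq β] (f : α → β)
    (w : k → k → ℝ) (E : α → Matrix k k ℂ) (F : β → Matrix k k ℂ) :
    ∑ a, wip w (E a) (F (f a)) = ∑ b, wip w (coarsen f E b) (F b) := by
  rw [← Finset.sum_fiberwise Finset.univ f]
  refine Finset.sum_congr rfl fun b _ => ?_
  rw [coarsen, wip_sum_left]
  exact Finset.sum_congr rfl fun a ha => by rw [(Finset.mem_filter.mp ha).2]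

end Wip

section POVM

variable {k α β : Type*} [Fintype k] [DecidableEq k] [Fintype α] [Fintype β]

lemma IsPOVM.one_sub {E : α → Matrix k k ℂ} (hE : IsPOVM E) (a : α) :
    (1 - E a).PosSemidef := by
  classical
  rw [← hE.2, ← Finset.sum_erase_eq_sub (Finset.mem_univ a)]
  exact Matrix.posSemidef_sum _ fun b _ => hE.1 b

lemma IsPOVM.isPOVM_coarsen [DecidableEq β] {E : α → Matrix k k ℂ} (hE : IsPOVM E) (f : α → β) :
    IsPOVM (coarsen f E) :=
  ⟨fun _ => Matrix.posSemidef_sum _ fun a _ => hE.1 a, by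
    simp only [coarsen, Finset.sum_fiberwise, hE.2]⟩

/-- A weight dominated by `(c i + c j) / 2` has total mass at most `∑ c` on a POVM. -/
lemma IsPOVM.sum_wip_self_le {E : α → Matrix k k ℂ} (hE : IsPOVM E) {w : k → k → ℝ}
    {c : k → ℝ} (hc : ∀ i, 0 ≤ c i) (hw : ∀ i j, w i j ≤ (c i + c j) / 2) :
    ∑ a, wip w (E a) (E a) ≤ ∑ i, c i := by
  have hrow : ∀ i, ∑ a, ∑ j, Complex.normSq (E a i j) ≤ 1 := by
    intro i
    have h : ∑ a, (E a i i).re = 1 := by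
      have := congrFun (congrFun hE.2 i) i
      rw [Matrix.sum_apply, Matrix.one_apply_eq] at this
      rw [← Complex.re_sum, this, Complex.one_re]
    rw [← h]
    exact Finset.sum_le_sum fun a _ => sum_normSq_row_le (hE.1 a) (hE.one_sub a) i
  have hsymm : ∀ a i j, Complex.normSq (E a i j) = Complex.normSq (E a j i) := by
    intro a i j
    rw [← (hE.1 a).1.apply j i, Complex.star_def, Complex.normSq_conj]
  calc ∑ a, wip w (E a) (E a)
      ≤ ∑ a, ∑ i, ∑ j, (c i + c j) / 2 * Complex.normSq (E a i j) := by
        refine Finset.sum_le_sum fun a _ => ?_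
        rw [wip_self (hE.1 a).1]
        exact Finset.sum_le_sum fun i _ => Finset.sum_le_sum fun j _ =>
          mul_le_mul_of_nonneg_right (hw i j) (Complex.normSq_nonneg _)
    _ = ∑ a, ∑ i, ∑ j, c i * Complex.normSq (E a i j) := by
        refine Finset.sum_congr rfl fun a _ => ?_
        have h1 : ∑ i, ∑ j, c j * Complex.normSq (E a i j) =
            ∑ i, ∑ j, c i * Complex.normSq (E a i j) := by
          rw [Finset.sum_comm]
          exact Finset.sum_congr rfl fun i _ => Finset.sum_congr rfl fun j _ => by
            rw [hsymm]
        have h2 : ∑ i, ∑ j, (c i + c j) / 2 * Complex.normSq (E a i j) =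
            (∑ i, ∑ j, c i * Complex.normSq (E a i j) +
              ∑ i, ∑ j, c j * Complex.normSq (E a i j)) / 2 := by
          simp only [← Finset.sum_add_distrib, Finset.sum_div]
          exact Finset.sum_congr rfl fun i _ => Finset.sum_congr rfl fun j _ => by ring
        rw [h2, h1]
        ring
    _ = ∑ i, c i * ∑ a, ∑ j, Complex.normSq (E a i j) := by
        rw [Finset.sum_comm]
        simp only [Finset.mul_sum]
    _ ≤ ∑ i, c i := by
        refine Finset.sum_le_sum fun i _ => ?_
        exact mul_le_of_le_one_right (hc i) (hrow i)

lemma IsPOVM.sum_wip_mul_self_le {E : α → Matrix k k ℂ} (hE : IsPOVM E) (s : k → ℝ) :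
    ∑ a, wip (fun i j => s i * s j) (E a) (E a) ≤ ∑ i, s i ^ 2 :=
  hE.sum_wip_self_le (fun i => sq_nonneg _) fun i j => by nlinarith [sq_nonneg (s i - s j)]

variable {s : k → ℝ} {E F : α → Matrix k k ℂ}

lemma IsPOVM.two_mul_sum_wip_le (hE : IsPOVM E) (hF : IsPOVM F) (hs : ∀ i, 0 ≤ s i) :
    2 * ∑ a, wip (fun i j => s i * s j) (E a) (F a) ≤
      ∑ a, wip (fun i j => s i * s j) (E a) (E a) + ∑ a, wip (fun i j => s i * s j) (F a) (F a) := by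
  rw [Finset.mul_sum, ← Finset.sum_add_distrib]
  exact Finset.sum_le_sum fun a _ => two_mul_wip_le (hE.1 a).1 (hF.1 a).1
    fun i j => mul_nonneg (hs i) (hs j)

lemma IsPOVM.deficit_left_le (hE : IsPOVM E) (hF : IsPOVM F) (hs : ∀ i, 0 ≤ s i) :
    ∑ i, s i ^ 2 - ∑ a, wip (fun i j => s i * s j) (E a) (E a) ≤
      2 * (∑ i, s i ^ 2 - ∑ a, wip (fun i j => s i * s j) (E a) (F a)) := by
  linarith [hE.two_mul_sum_wip_le hF hs, hF.sum_wip_mul_self_le s]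

lemma IsPOVM.deficit_right_le (hE : IsPOVM E) (hF : IsPOVM F) (hs : ∀ i, 0 ≤ s i) :
    ∑ i, s i ^ 2 - ∑ a, wip (fun i j => s i * s j) (F a) (F a) ≤
      2 * (∑ i, s i ^ 2 - ∑ a, wip (fun i j => s i * s j) (E a) (F a)) := by
  linarith [hE.two_mul_sum_wip_le hF hs, hE.sum_wip_mul_self_le s]

lemma IsPOVM.sum_wip_le (hE : IsPOVM E) (hF : IsPOVM F) (hs : ∀ i, 0 ≤ s i) :
    ∑ a, wip (fun i j => s i * s j) (E a) (F a) ≤ ∑ i, s i ^ 2 := by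
  linarith [hE.deficit_left_le hF hs, hE.sum_wip_mul_self_le s]

lemma sum_wip_coarsen_le [DecidableEq β] (hE : IsPOVM E) (hF : IsPOVM F) (f : α → β) :
    ∑ a, wip (fun i j => s i * s j) (E a) (F a) ≤
      ∑ b, wip (fun i j => s i * s j) (coarsen f E b) (coarsen f F b) := by
  rw [← Finset.sum_fiberwise Finset.univ f]
  refine Finset.sum_le_sum fun b _ => ?_
  rw [coarsen, wip_sum_left]
  refine Finset.sum_le_sum fun a ha => ?_
  rw [coarsen, wip_sum_right]
  exact Finset.single_le_sum (f := fun a' => wip (fun i j => s i * s j) (E a) (F a'))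
    (fun a' _ => wip_mul_nonneg s (hE.1 a) (hF.1 a')) ha

lemma wip_one_one : wip (fun i j => s i * s j) (1 : Matrix k k ℂ) 1 = ∑ i, s i ^ 2 := by
  simp only [wip]
  refine Finset.sum_congr rfl fun i _ => ?_
  rw [Finset.sum_eq_single i]
  · simp [sq]
  · intro j _ hj
    simp [Matrix.one_apply_ne hj]
  · simp

/-- The deficit of a coarsened POVM is carried by pairs of outcomes that `f` separates. -/
lemma IsPOVM.deficit_coarsen_eq [DecidableEq β] (hE : IsPOVM E) (f : α → β) :
    ∑ i, s i ^ 2 - ∑ b, wip (fun i j => s i * s j) (coarsen f E b) (coarsen f E b) =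
      ∑ a, ∑ a', if f a' ≠ f a then wip (fun i j => s i * s j) (E a) (E a') else 0 := by
  have h : ∑ i, s i ^ 2 = ∑ a, ∑ a', wip (fun i j => s i * s j) (E a) (E a') := by
    rw [← wip_one_one, ← hE.2, wip_sum_left]
    simp only [wip_sum_right]
  rw [h, ← sum_wip_comp, ← Finset.sum_sub_distrib]
  refine Finset.sum_congr rfl fun a _ => ?_
  rw [coarsen, wip_sum_right, Finset.sum_filter, ← Finset.sum_sub_distrib]
  refine Finset.sum_congr rfl fun a' _ => ?_
  by_cases h : f a' = f a <;> simp [h]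

/-- If the maps `f t` jointly separate the nonzero outcomes of a POVM, then its deficit is at most
the sum of the deficits of its coarsenings. -/
lemma IsPOVM.deficit_le_sum_coarsen {T : Type*} {γ : T → Type*} [∀ t, Fintype (γ t)]
    [∀ t, DecidableEq (γ t)] (hE : IsPOVM E) (S : Finset T) (f : ∀ t, α → γ t)
    (hsep : ∀ a a', a' ≠ a → E a = 0 ∨ E a' = 0 ∨ ∃ t ∈ S, f t a' ≠ f t a) :
    ∑ i, s i ^ 2 - ∑ a, wip (fun i j => s i * s j) (E a) (E a) ≤
      ∑ t ∈ S, (∑ i, s i ^ 2 -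
        ∑ b, wip (fun i j => s i * s j) (coarsen (f t) E b) (coarsen (f t) E b)) := by
  classical
  have hid : coarsen id E = E := by
    funext a
    simp [coarsen, Finset.sum_filter]
  have h0 := hE.deficit_coarsen_eq (s := s) id
  rw [hid] at h0
  rw [h0]
  simp only [hE.deficit_coarsen_eq]
  rw [Finset.sum_comm (s := S)]
  refine Finset.sum_le_sum fun a _ => ?_
  rw [Finset.sum_comm (s := S)]
  refine Finset.sum_le_sum fun a' _ => ?_
  have hnn := wip_mul_nonneg s (hE.1 a) (hE.1 a')
  have hnn' : ∀ t ∈ S, 0 ≤ if f t a' ≠ f t a then wip (fun i j => s i * s j) (E a) (E a') else 0 :=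
    fun t _ => by split_ifs <;> simp [hnn]
  by_cases haa : id a' ≠ id a
  · rw [if_pos haa]
    rcases hsep a a' haa with h | h | ⟨t, ht, h⟩
    · simp [h, wip]
    · simp [h, wip]
    · refine le_trans ?_ (Finset.single_le_sum hnn' ht)
      rw [if_pos h]
  · rw [if_neg haa]
    exact Finset.sum_nonneg hnn'

end POVM

section Factorization

open Matrix

variable {m k : Type*} [Fintype m] [Fintype k] [DecidableEq k]

/-- Right multiplication by a suitable unitary makes the columns of `M` orthogonal. -/
lemma exists_unitary_orthogonal_columns (M : Matrix m k ℂ) :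
    ∃ (V : Matrix k k ℂ) (l : k → ℝ), Vᴴ * V = 1 ∧ V * Vᴴ = 1 ∧ (∀ i, 0 ≤ l i) ∧
      (M * V)ᴴ * (M * V) = diagonal fun i => (l i : ℂ) := by
  obtain ⟨V, l, hV, hV', hl, h⟩ :=
    (posSemidef_conjTranspose_mul_self M).exists_unitary_diagonalization
  refine ⟨V, l, hV, hV', hl, ?_⟩
  rw [conjTranspose_mul, Matrix.mul_assoc, ← Matrix.mul_assoc Mᴴ, h, Matrix.mul_assoc _ Vᴴ, hV,
    Matrix.mul_one, ← Matrix.mul_assoc, hV, Matrix.one_mul]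

/-- A reduced singular value decomposition. -/
lemma exists_reduced_svd (K : Matrix m k ℂ) :
    ∃ (p : k → Prop) (_ : DecidablePred p) (X : Matrix m {i // p i} ℂ)
      (Y : Matrix k {i // p i} ℂ) (s : {i // p i} → ℝ), (∀ i, 0 < s i) ∧ Xᴴ * X = 1 ∧
      Yᴴ * Y = 1 ∧ K = X * diagonal (fun i => (s i : ℂ)) * Yᴴ := by
  classical
  obtain ⟨V, l, hV, hV', hl, hKV⟩ := exists_unitary_orthogonal_columns K
  set s : {i // l i ≠ 0} → ℝ := fun i => Real.sqrt (l i) with hs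
  have hspos : ∀ i, 0 < s i := fun i => Real.sqrt_pos.mpr (lt_of_le_of_ne (hl i) (Ne.symm i.2))
  have hentry : ∀ i j, ∑ x, star ((K * V) x i) * (K * V) x j = if i = j then (l i : ℂ) else 0 := by
    intro i j
    have := congrFun (congrFun hKV i) j
    rw [mul_apply, diagonal_apply] at this
    exact this
  refine ⟨fun i => l i ≠ 0, inferInstance, of fun x i => (K * V) x i * ((s i)⁻¹ : ℝ),
    of fun y i => V y i, s, hspos, ?_, ?_, ?_⟩
  · ext i j
    have h : ∀ x, star ((K * V) x i * ((s i)⁻¹ : ℝ)) * ((K * V) x j * ((s j)⁻¹ : ℝ)) =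
        star ((K * V) x i) * (K * V) x j * (((s i)⁻¹ * (s j)⁻¹ : ℝ) : ℂ) := by
      intro x
      rw [star_mul', Complex.star_def, Complex.conj_ofReal]
      push_cast
      ring
    rw [mul_apply]
    simp only [conjTranspose_apply, of_apply, h]
    rw [← Finset.sum_mul, hentry, one_apply]
    by_cases hij : i = j
    · subst hij
      have h2 : l i * ((s i)⁻¹ * (s i)⁻¹) = 1 := by
        have := Real.mul_self_sqrt (hl i)
        have h0 := (hspos i).ne'
        field_simp
        rw [sq]
        exact this.symm
      simp only [if_true]
      rw [← Complex.ofReal_mul, h2, Complex.ofReal_one]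
    · rw [if_neg hij, if_neg fun h => hij (Subtype.ext h), zero_mul]
  · ext i j
    have := congrFun (congrFun hV i) j
    rw [mul_apply] at this ⊢
    rw [one_apply] at this ⊢
    simpa [Subtype.ext_iff] using this
  · have hzero : ∀ x i, l i = 0 → (K * V) x i = 0 := by
      intro x i hi
      have h := hentry i i
      rw [if_pos rfl, hi, Complex.ofReal_zero] at h
      have h2 := (Finset.sum_eq_zero_iff_of_nonneg
        (fun x _ => star_mul_self_nonneg ((K * V) x i))).mp h x (Finset.mem_univ _)
      simpa using h2
    have hK : K = K * V * Vᴴ := by rw [Matrix.mul_assoc, hV', Matrix.mul_one]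
    conv_lhs => rw [hK]
    ext x y
    rw [mul_apply, mul_apply]
    simp only [mul_diagonal, conjTranspose_apply, of_apply]
    have h1 : ∀ i : {i // l i ≠ 0}, (K * V) x i * ((s i)⁻¹ : ℝ) * (s i : ℂ) = (K * V) x i := by
      intro i
      rw [mul_assoc, ← Complex.ofReal_mul, inv_mul_cancel₀ (hspos i).ne', Complex.ofReal_one,
        mul_one]
    simp only [h1]
    rw [← Finset.sum_filter_add_sum_filter_not _ (fun i => l i ≠ 0),
      Finset.sum_eq_zero (s := Finset.univ.filter fun i => ¬ l i ≠ 0) fun i hi => by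
        rw [hzero x i (not_not.mp (Finset.mem_filter.mp hi).2), zero_mul], add_zero]
    exact Finset.sum_subtype _ (fun i => by simp) _

/-- A contraction `M` has a unitary `U` with `Re Tr (Uᴴ M) ≥ Tr (Mᴴ M)`. -/
lemma exists_unitary_trace_ge {M : Matrix k k ℂ} (hM : (1 - M * Mᴴ).PosSemidef) :
    ∃ U : Matrix k k ℂ, Uᴴ * U = 1 ∧ U * Uᴴ = 1 ∧ (Mᴴ * M).trace.re ≤ (Uᴴ * M).trace.re := by
  obtain ⟨V, l, hV, hV', hl, hMV⟩ := exists_unitary_orthogonal_columns M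
  have hl1 : ∀ i, l i * l i ≤ l i := by
    intro i
    have h := hM.conjTranspose_mul_mul_same (M * V)
    have h2 : (M * V)ᴴ * (1 - M * Mᴴ) * (M * V) =
        (M * V)ᴴ * (M * V) - ((M * V)ᴴ * (M * V)) * ((M * V)ᴴ * (M * V)) := by
      have : M * Mᴴ = (M * V) * (M * V)ᴴ := by
        rw [conjTranspose_mul, Matrix.mul_assoc, ← Matrix.mul_assoc V, hV', Matrix.one_mul]
      rw [this]
      noncomm_ring
    rw [h2, hMV, diagonal_mul_diagonal, diagonal_sub] at h
    have h3 := (Complex.nonneg_iff.mp (h.diag_nonneg (i := i))).1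
    rw [diagonal_apply_eq] at h3
    simp only [Complex.sub_re, Complex.ofReal_re, ← Complex.ofReal_mul] at h3
    linarith
  have hsq : ∀ i, l i ≤ Real.sqrt (l i) := fun i =>
    Real.le_sqrt_of_sq_le (by rw [sq]; exact hl1 i)
  have hentry : ∀ i j, ∑ x, star ((M * V) x i) * (M * V) x j = if i = j then (l i : ℂ) else 0 := by
    intro i j
    have := congrFun (congrFun hMV i) j
    rw [mul_apply, diagonal_apply] at this
    exact this
  set v : k → EuclideanSpace ℂ k := fun i =>
    WithLp.toLp 2 fun x => (M * V) x i * (((Real.sqrt (l i))⁻¹ : ℝ) : ℂ) with hv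
  have hinner : ∀ i j, inner ℂ (v i) (v j) =
      (if i = j then (l i : ℂ) else 0) * (((Real.sqrt (l i))⁻¹ * (Real.sqrt (l j))⁻¹ : ℝ) : ℂ) := by
    intro i j
    rw [← hentry, Finset.sum_mul, PiLp.inner_apply]
    refine Finset.sum_congr rfl fun x _ => ?_
    simp only [hv, RCLike.inner_apply, map_mul, Complex.conj_ofReal, Complex.star_def]
    push_cast
    ring
  have horth : Orthonormal ℂ (Set.domRestrict {i | l i ≠ 0} v) := by
    rw [orthonormal_iff_ite]
    rintro ⟨i, hi⟩ ⟨j, hj⟩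
    simp only [Set.domRestrict_apply, hinner, Subtype.mk.injEq]
    by_cases hij : i = j
    · subst hij
      have h0 : Real.sqrt (l i) ≠ 0 := (Real.sqrt_pos.mpr (lt_of_le_of_ne (hl i) (Ne.symm hi))).ne'
      have h2 : l i * ((Real.sqrt (l i))⁻¹ * (Real.sqrt (l i))⁻¹) = 1 := by
        have := Real.mul_self_sqrt (hl i)
        field_simp
        rw [sq]
        exact this.symm
      rw [if_pos rfl, if_pos rfl, ← Complex.ofReal_mul, h2, Complex.ofReal_one]
    · rw [if_neg hij, if_neg hij, zero_mul]
  obtain ⟨b, hb⟩ := horth.exists_orthonormalBasis_extension_of_card_eq finrank_euclideanSpace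
  set B : Matrix k k ℂ := of fun x i => b i x with hB
  have hBB : Bᴴ * B = 1 := by
    ext i j
    have h := orthonormal_iff_ite.mp b.orthonormal i j
    rw [PiLp.inner_apply] at h
    rw [mul_apply, one_apply, ← h]
    refine Finset.sum_congr rfl fun x _ => ?_
    rw [RCLike.inner_apply, conjTranspose_apply, mul_comm]
    rfl
  have hBB' : B * Bᴴ = 1 := mul_eq_one_comm.mp hBB
  have hdiag : ∀ i, (Bᴴ * (M * V)) i i = (Real.sqrt (l i) : ℂ) := by
    intro i
    rw [mul_apply]
    by_cases hi : l i = 0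
    · have hz : ∀ x, (M * V) x i = 0 := by
        intro x
        have h := hentry i i
        rw [if_pos rfl, hi, Complex.ofReal_zero] at h
        have h2 := (Finset.sum_eq_zero_iff_of_nonneg
          (fun x _ => star_mul_self_nonneg ((M * V) x i))).mp h x (Finset.mem_univ _)
        simpa using h2
      simp [hz, hi]
    · have h1 : ∀ x, Bᴴ i x * (M * V) x i =
          star ((M * V) x i) * (M * V) x i * (((Real.sqrt (l i))⁻¹ : ℝ) : ℂ) := by
        intro x
        rw [conjTranspose_apply, hB]
        simp only [of_apply, hb i hi, hv, star_mul', Complex.star_def, Complex.conj_ofReal]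
        ring
      simp only [h1]
      rw [← Finset.sum_mul, hentry, if_pos rfl, ← Complex.ofReal_mul]
      congr 1
      rw [← div_eq_mul_inv, Real.div_sqrt]
  refine ⟨B * Vᴴ, ?_, ?_, ?_⟩
  · rw [conjTranspose_mul, conjTranspose_conjTranspose, Matrix.mul_assoc, ← Matrix.mul_assoc Bᴴ,
      hBB, Matrix.one_mul, hV']
  · rw [conjTranspose_mul, conjTranspose_conjTranspose, Matrix.mul_assoc, ← Matrix.mul_assoc Vᴴ,
      hV, Matrix.one_mul, hBB']
  · have h1 : (Mᴴ * M).trace = ((M * V)ᴴ * (M * V)).trace := by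
      rw [conjTranspose_mul, Matrix.mul_assoc, trace_mul_comm Vᴴ, Matrix.mul_assoc,
        Matrix.mul_assoc, hV', Matrix.mul_one]
    have h2 : ((B * Vᴴ)ᴴ * M).trace = (Bᴴ * (M * V)).trace := by
      rw [conjTranspose_mul, conjTranspose_conjTranspose, Matrix.mul_assoc, trace_mul_comm,
        Matrix.mul_assoc]
    rw [h1, h2, hMV, trace_diagonal, trace, Complex.re_sum, Complex.re_sum]
    refine Finset.sum_le_sum fun i _ => ?_
    rw [diag_apply, hdiag]
    exact hsq i

end Factorization

section Rounding

lemma exists_finset_card_eq_forall_le {τ : Type*} [Fintype τ] (l : τ → ℝ) (n : ℕ)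
    (hn : n ≤ Fintype.card τ) :
    ∃ S : Finset τ, S.card = n ∧ ∀ i ∈ S, ∀ j ∉ S, l j ≤ l i := by
  classical
  induction n with
  | zero => exact ⟨∅, rfl, by simp⟩
  | succ n ih =>
    obtain ⟨S, hS, hle⟩ := ih (by omega)
    have hne : Sᶜ.Nonempty := by
      rw [← Finset.card_pos, Finset.card_compl]
      omega
    obtain ⟨t, ht, hmax⟩ := Finset.exists_max_image Sᶜ l hne
    rw [Finset.mem_compl] at ht
    refine ⟨insert t S, by rw [Finset.card_insert_of_notMem ht, hS], ?_⟩
    intro i hi j hj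
    rw [Finset.mem_insert, not_or] at hj
    rcases Finset.mem_insert.mp hi with rfl | hi
    · exact hmax j (Finset.mem_compl.mpr hj.2)
    · exact hle i hi j hj.2

/-- Numbers in `[0, 1]` of total mass `n`, whose squares nearly sum to `n`, are concentrated on
`n` indices. -/
lemma exists_finset_sum_ge {τ : Type*} [Fintype τ] (l : τ → ℝ) (n : ℕ)
    (hn : n ≤ Fintype.card τ) (hl : ∀ t, l t * l t ≤ l t) (hsum : ∑ t, l t = n) :
    ∃ S : Finset τ, S.card = n ∧ ∑ t, l t * l t ≤ ∑ t ∈ S, l t := by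
  classical
  obtain ⟨S, hS, hle⟩ := exists_finset_card_eq_forall_le l n hn
  refine ⟨S, hS, ?_⟩
  have h0 : ∀ t, 0 ≤ l t := fun t => (mul_self_nonneg _).trans (hl t)
  have h1 : ∀ t, l t ≤ 1 := fun t => by nlinarith [hl t, h0 t]
  have hsplit := Finset.sum_add_sum_compl S l
  have hsplit2 := Finset.sum_add_sum_compl S fun t => l t * l t
  have hcard : ∑ t ∈ S, (1 - l t) = ∑ t ∈ Sᶜ, l t := by
    rw [Finset.sum_sub_distrib, Finset.sum_const, hS, nsmul_eq_mul, mul_one]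
    linarith
  obtain ⟨u, hu1, hu2⟩ : ∃ u : ℝ, (∀ i ∈ S, u ≤ l i) ∧ ∀ j ∉ S, l j ≤ u := by
    rcases S.eq_empty_or_nonempty with h | h
    · exact ⟨1, by simp [h], fun j _ => h1 j⟩
    · obtain ⟨i, hi, hmin⟩ := Finset.exists_min_image S l h
      exact ⟨l i, hmin, fun j hj => hle i hi j hj⟩
  have hA : ∑ t ∈ S, u * (1 - l t) ≤ ∑ t ∈ S, (l t - l t * l t) :=
    Finset.sum_le_sum fun t ht => by nlinarith [hu1 t ht, h1 t]
  have hB : ∑ t ∈ Sᶜ, (1 - u) * l t ≤ ∑ t ∈ Sᶜ, (l t - l t * l t) :=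
    Finset.sum_le_sum fun t ht => by nlinarith [hu2 t (Finset.mem_compl.mp ht), h0 t]
  rw [← Finset.mul_sum, hcard, Finset.sum_sub_distrib] at hA
  rw [← Finset.mul_sum, Finset.sum_sub_distrib] at hB
  linarith

open Matrix

variable {k α β : Type*} [Fintype k] [DecidableEq k] [Fintype α] [Fintype β]

lemma isPOVM_of_projections {r : α → Matrix k k ℂ}
    (hr : ∀ a, (r a).IsHermitian ∧ r a * r a = r a) (hr1 : ∑ a, r a = 1) : IsPOVM r := by
  refine ⟨fun a => ?_, hr1⟩
  have h := posSemidef_conjTranspose_mul_self (r a)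
  rwa [(hr a).1.eq, (hr a).2] at h

/-- **Orthogonalization of POVMs.**  A POVM that is nearly projective in the trace is close to a
projective measurement. -/
lemma IsPOVM.exists_projective_near [Nonempty α] {F : α → Matrix k k ℂ} (hF : IsPOVM F) :
    ∃ r : α → Matrix k k ℂ, (∀ a, (r a).IsHermitian ∧ r a * r a = r a) ∧ ∑ a, r a = 1 ∧
      (Fintype.card k : ℝ) - ∑ a, (r a * F a).trace.re ≤
        2 * (Fintype.card k - ∑ a, (F a * F a).trace.re) := by
  classical
  choose W l hFW hWW using fun a => (hF.1 a).exists_eq_mul_conjTranspose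
  set A : Matrix k (α × k) ℂ := of fun x t => W t.1 x t.2 with hA
  have hAA : A * Aᴴ = 1 := by
    rw [← hF.2]
    ext x y
    rw [mul_apply, Matrix.sum_apply, Fintype.sum_prod_type]
    refine Finset.sum_congr rfl fun a _ => ?_
    rw [hFW, mul_apply]
    rfl
  have hnorm : ∀ a m, ∑ x, star (W a x m) * W a x m = (l a m : ℂ) := by
    intro a m
    have h := congrFun (congrFun (hWW a) m) m
    rwa [mul_apply, diagonal_apply_eq] at h
  have hl : ∀ t : α × k, l t.1 t.2 * l t.1 t.2 ≤ l t.1 t.2 := by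
    rintro ⟨a, m⟩
    have h := (hF.one_sub a).conjTranspose_mul_mul_same (W a)
    have h2 : (W a)ᴴ * (1 - F a) * W a = (W a)ᴴ * W a - ((W a)ᴴ * W a) * ((W a)ᴴ * W a) := by
      rw [hFW]
      noncomm_ring
    rw [h2, hWW, diagonal_mul_diagonal, diagonal_sub] at h
    have h3 := (Complex.nonneg_iff.mp (h.diag_nonneg (i := m))).1
    rw [diagonal_apply_eq] at h3
    simp only [Complex.sub_re, Complex.ofReal_re, ← Complex.ofReal_mul] at h3
    simpa using h3
  have htr : ∀ a, (F a).trace.re = ∑ m, l a m := by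
    intro a
    rw [hFW, trace_mul_comm, hWW, trace_diagonal, Complex.re_sum]
    rfl
  have htr2 : ∀ a, (F a * F a).trace.re = ∑ m, l a m * l a m := by
    intro a
    rw [hFW, Matrix.mul_assoc, trace_mul_comm, Matrix.mul_assoc, Matrix.mul_assoc, hWW,
      ← Matrix.mul_assoc, hWW, diagonal_mul_diagonal, trace_diagonal, Complex.re_sum]
    simp only [← Complex.ofReal_mul, Complex.ofReal_re]
  have hsum : ∑ t : α × k, l t.1 t.2 = (Fintype.card k : ℕ) := by
    rw [Fintype.sum_prod_type]
    simp only [← htr]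
    rw [← Complex.re_sum, ← trace_sum, hF.2, trace_one, Complex.natCast_re]
  have hcard : Fintype.card k ≤ Fintype.card (α × k) := by
    rw [Fintype.card_prod]
    exact Nat.le_mul_of_pos_left _ Fintype.card_pos
  obtain ⟨S, hS, hSge⟩ := exists_finset_sum_ge (fun t : α × k => l t.1 t.2) _ hcard hl hsum
  rw [Fintype.sum_prod_type] at hSge
  simp only [← htr2] at hSge
  let e : k ≃ S := Fintype.equivOfCardEq (by rw [Fintype.card_coe, hS])
  set M : Matrix k k ℂ := of fun x m => A x (e m).1 with hM
  have hsumS : ∀ g : α × k → ℂ, ∑ m, g (e m).1 = ∑ t, if t ∈ S then g t else 0 := by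
    intro g
    rw [e.sum_comp (fun t : S => g t.1), Finset.sum_coe_sort S g, ← Finset.sum_filter]
    congr 1
    ext t
    simp
  have hMM : (1 - M * Mᴴ).PosSemidef := by
    have hD : (diagonal fun t : α × k => if t ∈ S then (0 : ℂ) else 1).PosSemidef :=
      PosSemidef.diagonal fun t => by
        dsimp only
        split_ifs <;> simp
    have h := hD.mul_mul_conjTranspose_same A
    convert h using 1
    rw [← hAA]
    ext x y
    have h1 : (M * Mᴴ) x y = ∑ t, if t ∈ S then A x t * star (A y t) else 0 := by
      rw [mul_apply, ← hsumS fun t => A x t * star (A y t)]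
      rfl
    rw [Matrix.sub_apply, h1, mul_apply, mul_apply, ← Finset.sum_sub_distrib]
    refine Finset.sum_congr rfl fun t _ => ?_
    rw [mul_diagonal, conjTranspose_apply]
    split_ifs <;> simp
  have hMtr : (Mᴴ * M).trace.re = ∑ t ∈ S, l t.1 t.2 := by
    have h : (Mᴴ * M).trace = ∑ m, ((fun t : α × k => (l t.1 t.2 : ℂ)) (e m).1) := by
      rw [trace]
      refine Finset.sum_congr rfl fun m _ => ?_
      rw [diag_apply, mul_apply]
      exact hnorm _ _
    rw [h, hsumS fun t => (l t.1 t.2 : ℂ), ← Finset.sum_filter, Complex.re_sum]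
    simp
  obtain ⟨U, hU, hU', hUM⟩ := exists_unitary_trace_ge hMM
  set D : α → Matrix k k ℂ := fun a => diagonal fun m => if (e m).1.1 = a then 1 else 0 with hD
  have hDh : ∀ a, (D a)ᴴ = D a := by
    intro a
    rw [hD, diagonal_conjTranspose]
    congr 1
    funext m
    rw [Pi.star_apply]
    split_ifs <;> simp
  have hDD : ∀ a, D a * D a = D a := by
    intro a
    rw [hD, diagonal_mul_diagonal]
    congr 1
    funext m
    split_ifs <;> simp
  have hD1 : ∑ a, D a = 1 := by
    ext x y
    rw [Matrix.sum_apply, one_apply]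
    simp only [hD, diagonal_apply]
    by_cases hxy : x = y <;> simp [hxy]
  refine ⟨fun a => U * D a * Uᴴ, fun a => ⟨?_, ?_⟩, ?_, ?_⟩
  · rw [IsHermitian, conjTranspose_mul, conjTranspose_mul, conjTranspose_conjTranspose, hDh]
    exact (Matrix.mul_assoc _ _ _).symm
  · calc U * D a * Uᴴ * (U * D a * Uᴴ) = U * D a * (Uᴴ * U) * D a * Uᴴ := by noncomm_ring
      _ = U * D a * Uᴴ := by rw [hU, Matrix.mul_one, Matrix.mul_assoc U, hDD]
  · rw [← Finset.sum_mul, ← Finset.mul_sum, hD1, Matrix.mul_one, hU']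
  · have hval : ∀ a, (U * D a * Uᴴ * F a).trace.re =
        ∑ m, if (e m).1.1 = a then ∑ j, Complex.normSq ((Uᴴ * W a) m j) else 0 := by
      intro a
      have h1 : (U * D a * Uᴴ * F a).trace = (D a * ((Uᴴ * W a) * (Uᴴ * W a)ᴴ)).trace := by
        rw [hFW, conjTranspose_mul, conjTranspose_conjTranspose, Matrix.mul_assoc,
          Matrix.mul_assoc, trace_mul_comm]
        congr 1
        noncomm_ring
      rw [h1, trace, Complex.re_sum]
      refine Finset.sum_congr rfl fun m _ => ?_
      rw [diag_apply, hD, diagonal_mul, mul_apply]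
      split_ifs
      · rw [one_mul, Complex.re_sum]
        refine Finset.sum_congr rfl fun j _ => ?_
        rw [conjTranspose_apply, Complex.star_def, Complex.mul_conj, Complex.ofReal_re]
      · simp
    have hcol : ∀ m, (Uᴴ * W (e m).1.1) m (e m).1.2 = (Uᴴ * M) m m := fun m => by
      rw [mul_apply, mul_apply]
      rfl
    have hge : ∑ m, (2 * ((Uᴴ * M) m m).re - 1) ≤ ∑ a, (U * D a * Uᴴ * F a).trace.re := by
      simp only [hval]
      rw [Finset.sum_comm]
      refine Finset.sum_le_sum fun m _ => ?_
      rw [Finset.sum_ite_eq, if_pos (Finset.mem_univ _)]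
      refine le_trans ?_ (Finset.single_le_sum (fun j _ => Complex.normSq_nonneg _)
        (Finset.mem_univ (e m).1.2))
      rw [hcol, Complex.normSq_apply]
      nlinarith [sq_nonneg (((Uᴴ * M) m m).re - 1), mul_self_nonneg ((Uᴴ * M) m m).im]
    rw [Finset.sum_sub_distrib, ← Finset.mul_sum, ← Complex.re_sum, Finset.sum_const,
      Finset.card_univ, nsmul_eq_mul, mul_one] at hge
    have : (Uᴴ * M).trace = ∑ m, (Uᴴ * M) m m := rfl
    rw [← this] at hge
    dsimp only
    linarith

lemma normSq_sub_le (x y z w : ℂ) : Complex.normSq (x - w) ≤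
    3 * (Complex.normSq (x - y) + Complex.normSq (y - z) + Complex.normSq (z - w)) := by
  simp only [Complex.normSq_apply, Complex.sub_re, Complex.sub_im]
  nlinarith [sq_nonneg ((x.re - y.re) - (y.re - z.re)), sq_nonneg ((y.re - z.re) - (z.re - w.re)),
    sq_nonneg ((x.re - y.re) - (z.re - w.re)), sq_nonneg ((x.im - y.im) - (y.im - z.im)),
    sq_nonneg ((y.im - z.im) - (z.im - w.im)), sq_nonneg ((x.im - y.im) - (z.im - w.im))]

/-- The winning deficit of projective measurements close to given POVMs. -/
lemma deficit_projective_le [DecidableEq β] {F r : α → Matrix k k ℂ} {Y s : β → Matrix k k ℂ}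
    (hF : IsPOVM F) (hY : IsPOVM Y) (f : α → β)
    (hr : ∀ a, (r a).IsHermitian ∧ r a * r a = r a) (hr1 : ∑ a, r a = 1)
    (hs : ∀ b, (s b).IsHermitian ∧ s b * s b = s b) (hs1 : ∑ b, s b = 1)
    (hrF : (Fintype.card k : ℝ) - ∑ a, (r a * F a).trace.re ≤
      2 * (Fintype.card k - ∑ a, (F a * F a).trace.re))
    (hsY : (Fintype.card k : ℝ) - ∑ b, (s b * Y b).trace.re ≤
      2 * (Fintype.card k - ∑ b, (Y b * Y b).trace.re)) :
    (Fintype.card k : ℝ) - ∑ a, (r a * s (f a)).trace.re ≤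
      6 * (Fintype.card k - ∑ a, (F a * F a).trace.re) +
        15 * (Fintype.card k - ∑ a, (F a * Y (f a)).trace.re) := by
  have hrP := isPOVM_of_projections hr hr1
  have hsP := isPOVM_of_projections hs hs1
  have hR := hrP.isPOVM_coarsen f
  have hG := hF.isPOVM_coarsen f
  have hrr : ∑ a, (r a * r a).trace.re = Fintype.card k := by
    simp only [(hr _).2]
    rw [← Complex.re_sum, ← trace_sum, hr1, trace_one, Complex.natCast_re]
  have hss : ∑ b, (s b * s b).trace.re = Fintype.card k := by
    simp only [(hs _).2]
    rw [← Complex.re_sum, ← trace_sum, hs1, trace_one, Complex.natCast_re]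
  have hone : ∀ i : k, (0 : ℝ) ≤ (fun _ => 1) i := fun _ => zero_le_one
  have a1 := sum_wip_coarsen_le (s := fun _ => 1) hrP hrP f
  have a2 := sum_wip_coarsen_le (s := fun _ => 1) hrP hF f
  have a3 := hG.deficit_right_le hY hone
  have a4 := hG.sum_wip_mul_self_le fun _ => 1
  have a5 := hR.sum_wip_mul_self_le fun _ => 1
  have a6 := hY.sum_wip_mul_self_le fun _ => 1
  have a7 := sum_wip_comp f (fun _ _ => 1) r s
  have a8 := sum_wip_comp f (fun _ _ => 1) F Y
  have key : ∑ b, (wip (fun _ _ => 1) (coarsen f r b) (coarsen f r b) +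
      wip (fun _ _ => 1) (s b) (s b) - 2 * wip (fun _ _ => 1) (coarsen f r b) (s b)) ≤
      ∑ b, 3 * ((wip (fun _ _ => 1) (coarsen f r b) (coarsen f r b) +
        wip (fun _ _ => 1) (coarsen f F b) (coarsen f F b) -
        2 * wip (fun _ _ => 1) (coarsen f r b) (coarsen f F b)) +
      (wip (fun _ _ => 1) (coarsen f F b) (coarsen f F b) + wip (fun _ _ => 1) (Y b) (Y b) -
        2 * wip (fun _ _ => 1) (coarsen f F b) (Y b)) +
      (wip (fun _ _ => 1) (s b) (s b) + wip (fun _ _ => 1) (Y b) (Y b) -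
        2 * wip (fun _ _ => 1) (s b) (Y b))) := by
    refine Finset.sum_le_sum fun b _ => ?_
    rw [← sum_normSq_sub (hR.1 b).1 (hs b).1, ← sum_normSq_sub (hR.1 b).1 (hG.1 b).1,
      ← sum_normSq_sub (hG.1 b).1 (hY.1 b).1, ← sum_normSq_sub (hs b).1 (hY.1 b).1]
    simp only [one_mul, ← Finset.sum_add_distrib, Finset.mul_sum]
    refine Finset.sum_le_sum fun i _ => Finset.sum_le_sum fun j _ => ?_
    have := normSq_sub_le (coarsen f r b i j) (coarsen f F b i j) (Y b i j) (s b i j)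
    rw [← Complex.normSq_neg (s b i j - Y b i j), neg_sub]
    exact this
  simp only [Finset.sum_add_distrib, Finset.sum_sub_distrib, ← Finset.mul_sum, wip_one_eq_trace,
    mul_one, one_pow, Finset.sum_const, Finset.card_univ, nsmul_eq_mul] at *
  linarith

end Rounding

section Threshold

/-- **Layer-cake extraction.**  If a kernel has nonnegative integral against `min (w k) (w l)` for
some positive weights `w`, then it has nonnegative sum over `T ×ˢ T` for a level set `T` of `w`. -/
lemma exists_finset_sum_nonneg_of_min {ι : Type*} (g : ι → ι → ℝ) (S : Finset ι) :
    ∀ w : ι → ℝ, S.Nonempty → (∀ k ∈ S, 0 < w k) →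
      0 ≤ ∑ k ∈ S, ∑ l ∈ S, min (w k) (w l) * g k l →
      ∃ T : Finset ι, T.Nonempty ∧ 0 ≤ ∑ k ∈ T, ∑ l ∈ T, g k l := by
  classical
  induction S using Finset.strongInduction with
  | H S ih =>
    intro w hS hw h
    by_cases hG : 0 ≤ ∑ k ∈ S, ∑ l ∈ S, g k l
    · exact ⟨S, hS, hG⟩
    push Not at hG
    obtain ⟨k₀, hk₀, hmin⟩ := Finset.exists_min_image S w hS
    have hsum : ∑ k ∈ S with w k₀ < w k, ∑ l ∈ S with w k₀ < w l,
        min (w k - w k₀) (w l - w k₀) * g k l =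
        ∑ k ∈ S, ∑ l ∈ S, min (w k) (w l) * g k l - w k₀ * ∑ k ∈ S, ∑ l ∈ S, g k l := by
      simp only [Finset.sum_filter, Finset.mul_sum, ← Finset.sum_sub_distrib]
      refine Finset.sum_congr rfl fun k hk => ?_
      have hk' := hmin k hk
      split_ifs with h1
      · refine Finset.sum_congr rfl fun l hl => ?_
        have hl' := hmin l hl
        split_ifs with h2
        · rw [min_sub_sub_right]
          ring
        · rw [min_eq_right (by linarith), show w l = w k₀ by linarith, sub_self]
      · refine (Finset.sum_eq_zero fun l hl => ?_).symm
        have hl' := hmin l hl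
        rw [min_eq_left (by linarith), show w k = w k₀ by linarith, sub_self]
    have hpos : 0 < ∑ k ∈ S with w k₀ < w k, ∑ l ∈ S with w k₀ < w l,
        min (w k - w k₀) (w l - w k₀) * g k l := by
      rw [hsum]
      nlinarith [hw k₀ hk₀]
    refine ih (S.filter fun k => w k₀ < w k)
      (Finset.filter_ssubset.mpr ⟨k₀, hk₀, lt_irrefl (w k₀)⟩) (fun k => w k - w k₀) ?_
      (fun k hk => sub_pos.mpr (Finset.mem_filter.mp hk).2) hpos.le
    by_contra hne
    rw [Finset.not_nonempty_iff_eq_empty] at hne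
    rw [hne, Finset.sum_empty] at hpos
    exact lt_irrefl _ hpos

lemma exists_embedding_sum_nonneg_of_min {ι : Type*} [Fintype ι] [Nonempty ι] (g : ι → ι → ℝ)
    (w : ι → ℝ) (hw : ∀ k, 0 < w k) (h : 0 ≤ ∑ k, ∑ l, min (w k) (w l) * g k l) :
    ∃ (n : ℕ) (e : Fin n → ι), 1 ≤ n ∧ Function.Injective e ∧ 0 ≤ ∑ k, ∑ l, g (e k) (e l) := by
  obtain ⟨T, hT, hTg⟩ := exists_finset_sum_nonneg_of_min g Finset.univ w Finset.univ_nonempty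
    (fun k _ => hw k) h
  refine ⟨T.card, fun m => (T.equivFin.symm m).1, Finset.card_pos.mpr hT,
    Subtype.val_injective.comp T.equivFin.symm.injective, ?_⟩
  rw [T.equivFin.symm.sum_comp fun k : T => ∑ l, g k.1 (T.equivFin.symm l).1]
  simp only [fun k : T => T.equivFin.symm.sum_comp fun l : T => g k.1 l.1]
  rw [Finset.sum_coe_sort T fun k => ∑ l : T, g k l.1]
  simp only [fun k => Finset.sum_coe_sort T fun l => g k l]
  exact hTg

end Threshold

section Connes

variable {k α : Type*} [Fintype k] [Fintype α]

lemma wip_sub_smul (v w : k → k → ℝ) (t : ℝ) (X Y : Matrix k k ℂ) :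
    wip (fun i j => v i j - t * w i j) X Y = wip v X Y - t * wip w X Y := by
  simp only [wip, Finset.mul_sum, ← Finset.sum_sub_distrib]
  exact Finset.sum_congr rfl fun i _ => Finset.sum_congr rfl fun j _ => by ring

/-- Replacing the weight `s i * s j` by `min (s i ^ 2) (s j ^ 2)` costs little when the first
measurement has small deficit. -/
lemma IsPOVM.deficit_min_le [DecidableEq k] {E F : α → Matrix k k ℂ} (hE : IsPOVM E) (hF : IsPOVM F)
    {s : k → ℝ} (hs : ∀ i, 0 ≤ s i) {c : ℝ} (hc : 0 < c) :
    ∑ i, s i ^ 2 - ∑ a, wip (fun i j => min (s i ^ 2) (s j ^ 2)) (E a) (F a) ≤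
      (∑ i, s i ^ 2 - ∑ a, wip (fun i j => s i * s j) (E a) (F a)) +
        c⁻¹ * (∑ i, s i ^ 2 - ∑ a, wip (fun i j => s i * s j) (E a) (E a)) +
        c / 2 * ∑ i, s i ^ 2 := by
  have hmin : ∑ a, wip (fun i j => min (s i ^ 2) (s j ^ 2)) (F a) (F a) ≤ ∑ i, s i ^ 2 :=
    hF.sum_wip_self_le (fun i => sq_nonneg _) fun i j => by
      rcases le_total (s i ^ 2) (s j ^ 2) with h | h
      · rw [min_eq_left h]; linarith
      · rw [min_eq_right h]; linarith
  have hsq : ∑ a, wip (fun i j => (s i ^ 2 + s j ^ 2) - 2 * (s i * s j)) (E a) (E a) ≤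
      2 * (∑ i, s i ^ 2 - ∑ a, wip (fun i j => s i * s j) (E a) (E a)) := by
    have h := hE.sum_wip_self_le (w := fun i j => s i ^ 2 + s j ^ 2) (c := fun i => 2 * s i ^ 2)
      (fun i => by positivity) fun i j => by linarith
    rw [← Finset.mul_sum] at h
    simp only [wip_sub_smul, Finset.sum_sub_distrib, ← Finset.mul_sum]
    linarith
  have hpt : ∀ i j (x y : ℂ), (s i * s j - min (s i ^ 2) (s j ^ 2)) * (x * y).re ≤
      c⁻¹ / 2 * (((s i ^ 2 + s j ^ 2) - 2 * (s i * s j)) * Complex.normSq x) +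
        c / 2 * (min (s i ^ 2) (s j ^ 2) * Complex.normSq y) := by
    intro i j x y
    have main : ∀ m d : ℝ, m * d * (x * y).re ≤
        c⁻¹ / 2 * (d ^ 2 * Complex.normSq x) + c / 2 * (m ^ 2 * Complex.normSq y) := by
      intro m d
      have h : c⁻¹ / 2 * (d ^ 2 * Complex.normSq x) + c / 2 * (m ^ 2 * Complex.normSq y) -
          m * d * (x * y).re =
          c⁻¹ / 2 * ((d * x.re - c * m * y.re) ^ 2 + (d * x.im + c * m * y.im) ^ 2) := by
        rw [Complex.normSq_apply, Complex.normSq_apply, Complex.mul_re]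
        field_simp
        ring
      have : 0 ≤ c⁻¹ / 2 * ((d * x.re - c * m * y.re) ^ 2 + (d * x.im + c * m * y.im) ^ 2) := by
        positivity
      linarith
    rcases le_total (s i) (s j) with h | h
    · rw [min_eq_left (pow_le_pow_left₀ (hs i) h 2)]
      convert main (s i) (s j - s i) using 2 <;> ring
    · rw [min_eq_right (pow_le_pow_left₀ (hs j) h 2)]
      convert main (s j) (s i - s j) using 2 <;> ring
  have hsum : ∑ a, wip (fun i j => s i * s j) (E a) (F a) -
      ∑ a, wip (fun i j => min (s i ^ 2) (s j ^ 2)) (E a) (F a) ≤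
      c⁻¹ / 2 * ∑ a, wip (fun i j => (s i ^ 2 + s j ^ 2) - 2 * (s i * s j)) (E a) (E a) +
        c / 2 * ∑ a, wip (fun i j => min (s i ^ 2) (s j ^ 2)) (F a) (F a) := by
    simp only [wip_self (hE.1 _).1, wip_self (hF.1 _).1]
    simp only [wip, Finset.mul_sum, ← Finset.sum_sub_distrib, ← Finset.sum_add_distrib]
    refine Finset.sum_le_sum fun a _ => Finset.sum_le_sum fun i _ =>
      Finset.sum_le_sum fun j _ => ?_
    have h := hpt i j (E a i j) (F a j i)
    rw [← (hF.1 a).1.apply j i, Complex.star_def, Complex.normSq_conj] at h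
    rw [← (hF.1 a).1.apply j i, Complex.star_def]
    linarith
  have h1 := mul_le_mul_of_nonneg_left hsq (show 0 ≤ c⁻¹ / 2 by positivity)
  have h2 := mul_le_mul_of_nonneg_left hmin (show 0 ≤ c / 2 by positivity)
  linarith

end Connes

section Games

open Matrix

lemma sum_sum_mul_sum {ι κ τ : Type*} [Fintype ι] [Fintype κ] [Fintype τ] (w : ι → κ → ℝ)
    (h : τ → ι → κ → ℝ) :
    ∑ k, ∑ l, w k l * ∑ t, h t k l = ∑ t, ∑ k, ∑ l, w k l * h t k l := by
  simp only [Finset.mul_sum]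
  rw [Finset.sum_comm]
  conv_rhs => rw [Finset.sum_comm]
  rw [Finset.sum_comm]
  exact Finset.sum_congr rfl fun _ _ => Finset.sum_comm

lemma sum_sum_mul_const_mul {ι κ : Type*} [Fintype ι] [Fintype κ] (w : ι → κ → ℝ) (c : ℝ)
    (h : ι → κ → ℝ) :
    ∑ k, ∑ l, w k l * (c * h k l) = c * ∑ k, ∑ l, w k l * h k l := by
  simp only [Finset.mul_sum]
  exact Finset.sum_congr rfl fun _ _ => Finset.sum_congr rfl fun _ _ => by ring

lemma IsPOVM.submatrix {α k m : Type*} [Fintype α] [Fintype k] [DecidableEq k] [Fintype m]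
    [DecidableEq m] {E : α → Matrix k k ℂ} (hE : IsPOVM E) {e : m → k}
    (he : Function.Injective e) : IsPOVM fun a => (E a).submatrix e e := by
  refine ⟨fun a => (hE.1 a).submatrix e, ?_⟩
  rw [← submatrix_one e he, ← hE.2]
  ext i j
  simp [Matrix.sum_apply]

variable {I J : Type*} {R : Type} [Fintype I] [Fintype J] [Fintype R] [DecidableEq R]
  {A : I → Type*} [∀ i, Fintype (A i)] {B : J → Type*} [∀ j, Fintype (B j)]

/-- Measurements whose deficits are small against the weight `min (s k ^ 2) (s l ^ 2)` yield
projective measurements in a matrix algebra with good winning probability in the trace. -/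
lemma exists_projective_strategy [∀ i, Nonempty (A i)] [∀ j, Nonempty (B j)]
    (μ : I → J → ℝ) (hμ0 : ∀ i j, 0 ≤ μ i j) (hμ1 : ∑ i, ∑ j, μ i j = 1)
    (p : ∀ i j, A i → B j) {E : ∀ i, A i → Matrix R R ℂ} {X : ∀ j, B j → Matrix R R ℂ}
    (hE : ∀ i, IsPOVM (E i)) (hX : ∀ j, IsPOVM (X j)) (s : R → ℝ) (hs : ∀ k, 0 < s k)
    (hs1 : ∑ k, s k ^ 2 = 1) (Δ : ℝ)
    (h : 6 * (1 - ∑ i, ∑ j, μ i j *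
          ∑ a, wip (fun k l => min (s k ^ 2) (s l ^ 2)) (E i a) (E i a)) +
        15 * (1 - ∑ i, ∑ j, μ i j *
          ∑ a, wip (fun k l => min (s k ^ 2) (s l ^ 2)) (E i a) (X j (p i j a))) ≤ Δ) :
    ∃ (n : ℕ) (r : ∀ i, A i → Matrix (Fin n) (Fin n) ℂ)
      (t : ∀ j, B j → Matrix (Fin n) (Fin n) ℂ), 1 ≤ n ∧
      (∀ i a, (r i a).IsHermitian ∧ r i a * r i a = r i a) ∧ (∀ i, ∑ a, r i a = 1) ∧
      (∀ j b, (t j b).IsHermitian ∧ t j b * t j b = t j b) ∧ (∀ j, ∑ b, t j b = 1) ∧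
      (1 - Δ) * n ≤ ∑ i, ∑ j, μ i j * ∑ a, (r i a * t j (p i j a)).trace.re := by
  classical
  have hne : Nonempty R := by
    by_contra hR
    rw [not_nonempty_iff] at hR
    simp at hs1
  set g : R → R → ℝ := fun k l =>
    ∑ i, ∑ j, μ i j * (6 * ∑ a, (E i a k l * E i a l k).re +
      15 * ∑ a, (E i a k l * X j (p i j a) l k).re) -
    (21 - Δ) * (if k = l then 1 else 0) with hg
  have hgsum : ∀ {m : Type} [Fintype m] [DecidableEq m] (e : m → R),
      Function.Injective e → ∀ w : m → m → ℝ,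
      ∑ k, ∑ l, w k l * g (e k) (e l) =
        ∑ i, ∑ j, μ i j *
          (6 * ∑ a, wip w ((E i a).submatrix e e) ((E i a).submatrix e e) +
          15 * ∑ a, wip w ((E i a).submatrix e e) ((X j (p i j a)).submatrix e e)) -
        (21 - Δ) * ∑ k, w k k := by
    intro m _ _ e he w
    simp only [hg, mul_sub, Finset.sum_sub_distrib, sum_sum_mul_sum]
    congr 1
    · refine Finset.sum_congr rfl fun i _ => Finset.sum_congr rfl fun j _ => ?_
      rw [sum_sum_mul_const_mul]
      simp only [mul_add, Finset.sum_add_distrib, sum_sum_mul_const_mul, sum_sum_mul_sum]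
      rfl
    · rw [sum_sum_mul_const_mul]
      simp [he.eq_iff]
  have hmin : 0 ≤ ∑ k, ∑ l, min (s k ^ 2) (s l ^ 2) * g k l := by
    have h1 := hgsum id Function.injective_id fun k l => min (s k ^ 2) (s l ^ 2)
    simp only [submatrix_id_id, min_self, hs1, id] at h1
    rw [h1]
    simp only [mul_add, Finset.sum_add_distrib, sum_sum_mul_const_mul]
    linarith
  obtain ⟨n, e, hn, he, hge⟩ := exists_embedding_sum_nonneg_of_min g (fun k => s k ^ 2)
    (fun k => pow_pos (hs k) 2) hmin
  have h1 := hgsum e he fun _ _ => 1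
  simp only [one_mul, wip_one_eq_trace, Finset.sum_const, Finset.card_univ, Fintype.card_fin,
    nsmul_eq_mul, mul_one] at h1
  rw [h1] at hge
  have hE' := fun i => (hE i).submatrix he
  have hX' := fun j => (hX j).submatrix he
  choose r hr hr1 hrE using fun i => (hE' i).exists_projective_near
  choose t ht ht1 htX using fun j => (hX' j).exists_projective_near
  refine ⟨n, r, t, hn, hr, hr1, ht, ht1, ?_⟩
  have key : ∀ i j, μ i j * (n - ∑ a, (r i a * t j (p i j a)).trace.re) ≤ μ i j * (21 * n -
      (6 * ∑ a, ((E i a).submatrix e e * (E i a).submatrix e e).trace.re +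
        15 * ∑ a, ((E i a).submatrix e e * (X j (p i j a)).submatrix e e).trace.re)) := by
    intro i j
    have h2 := deficit_projective_le (hE' i) (hX' j) (p i j) (hr i) (hr1 i) (ht j) (ht1 j)
      (hrE i) (htX j)
    rw [Fintype.card_fin] at h2
    exact mul_le_mul_of_nonneg_left (by linarith) (hμ0 i j)
  have hsum := Finset.sum_le_sum fun i (_ : i ∈ Finset.univ) =>
    Finset.sum_le_sum fun j (_ : j ∈ Finset.univ) => key i j
  simp only [mul_sub, Finset.sum_sub_distrib, ← Finset.sum_mul, hμ1] at hsum
  linarith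

end Games

section Reduction

open Matrix

lemma coarsen_coarsen {α β k : Type*} [Fintype α] [DecidableEq α] [DecidableEq β] {f : α → α}
    {g : α → β} (h : ∀ a, g (f a) = g a) (E : α → Matrix k k ℂ) :
    coarsen g (coarsen f E) = coarsen g E := by
  funext b
  simp only [coarsen]
  rw [Finset.sum_comm' (t' := Finset.univ.filter fun a => g a = b) (s' := fun a => {f a})]
  · simp
  · intro a a'
    simp only [Finset.mem_filter, Finset.mem_univ, true_and, Finset.mem_singleton]
    constructor
    · rintro ⟨h1, rfl⟩
      exact ⟨rfl, by rw [← h, h1]⟩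
    · rintro ⟨rfl, h2⟩
      exact ⟨by rw [h, h2], rfl⟩

lemma le_add_sqrt_of_forall_pos {x e : ℝ} (he : 0 ≤ e)
    (h : ∀ c : ℝ, 0 < c → x ≤ 27 * e + 42 * (e * c⁻¹) + 21 / 2 * c) :
    x ≤ 27 * e + 42 * √e := by
  rcases he.eq_or_lt with rfl | he
  · refine le_of_forall_pos_le_add fun δ hδ => ?_
    have := h (δ / 11) (by positivity)
    simp at this ⊢
    linarith
  · have hs := Real.sqrt_pos.mpr he
    have h1 := h (2 * √e) (by positivity)
    have h2 : e * (2 * √e)⁻¹ = √e / 2 := by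
      field_simp
      exact (Real.sq_sqrt he.le).symm
    rw [h2] at h1
    linarith

/-- The winning bound for projective measurements obtained from measurements in
bipartite diagonal form `∑ k l, s k * s l * E k l * X l k`. -/
lemma exists_projective_strategy_of_value {I J : Type*} {R : Type} [Fintype I] [Fintype J]
    [Fintype R] [DecidableEq R] {A : I → Type*} [∀ i, Fintype (A i)] {B : J → Type*}
    [∀ j, Fintype (B j)] [∀ i, Nonempty (A i)] [∀ j, Nonempty (B j)]
    (μ : I → J → ℝ) (hμ0 : ∀ i j, 0 ≤ μ i j) (hμ1 : ∑ i, ∑ j, μ i j = 1)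
    (p : ∀ i j, A i → B j) {L : ℝ} (hL1 : 1 ≤ L)
    (hL : ∀ i j, 0 < μ i j → ∑ j', μ i j' ≤ L * μ i j)
    {P : ∀ i, A i → Matrix R R ℂ} {X : ∀ j, B j → Matrix R R ℂ}
    (hP : ∀ i, IsPOVM (P i)) (hX : ∀ j, IsPOVM (X j)) (s : R → ℝ) (hs : ∀ k, 0 < s k)
    (hs1 : ∑ k, s k ^ 2 = 1) (ε : ℝ)
    (hw : 1 - ε ≤ ∑ i, ∑ j, μ i j *
      ∑ a, wip (fun k l => s k * s l) (P i a) (X j (p i j a))) :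
    0 ≤ ε ∧ ∃ (n : ℕ) (r : ∀ i, A i → Matrix (Fin n) (Fin n) ℂ)
      (t : ∀ j, B j → Matrix (Fin n) (Fin n) ℂ), 1 ≤ n ∧
      (∀ i a, (r i a).IsHermitian ∧ r i a * r i a = r i a) ∧ (∀ i, ∑ a, r i a = 1) ∧
      (∀ j b, (t j b).IsHermitian ∧ t j b * t j b = t j b) ∧ (∀ j, ∑ b, t j b = 1) ∧
      (1 - (27 * (L * ε) + 42 * √(L * ε))) * n ≤
        ∑ i, ∑ j, μ i j * ∑ a, (r i a * t j (p i j a)).trace.re := by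
  classical
  have hs0 := fun k => (hs k).le
  have hrep : ∀ i, ∃ rep : A i → A i, (∀ j, 0 < μ i j → ∀ a, p i j (rep a) = p i j a) ∧
      ∀ a a', (∀ j, 0 < μ i j → p i j a = p i j a') → rep a = rep a' := by
    intro i
    let S : Setoid (A i) := ⟨fun a a' => ∀ j, 0 < μ i j → p i j a = p i j a',
      fun _ _ _ => rfl, fun h j hj => (h j hj).symm, fun h h' j hj => (h j hj).trans (h' j hj)⟩
    exact ⟨fun a => (Quotient.mk S a).out, fun j hj a => Quotient.mk_out (s := S) a j hj,
      fun a a' h => congrArg Quotient.out (Quotient.sound (s := S) h)⟩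
  choose rep hrep hrep' using hrep
  set E : ∀ i, A i → Matrix R R ℂ := fun i => coarsen (rep i) (P i) with hEdef
  have hE : ∀ i, IsPOVM (E i) := fun i => (hP i).isPOVM_coarsen _
  have hEne : ∀ i a, E i a ≠ 0 → ∃ a₀, rep i a₀ = a := by
    intro i a h
    by_contra! hne
    refine h ?_
    simp [hEdef, coarsen, hne]
  set C : ∀ i j, B j → Matrix R R ℂ := fun i j => coarsen (p i j) (E i) with hCdef
  have hC : ∀ i j, IsPOVM (C i j) := fun i j => (hE i).isPOVM_coarsen _
  set d : I → J → ℝ := fun i j => 1 - ∑ b, wip (fun k l => s k * s l) (C i j b) (X j b) with hd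
  have hd0 : ∀ i j, 0 ≤ d i j := fun i j => by
    have := (hC i j).sum_wip_le (hX j) hs0
    rw [hs1] at this
    exact sub_nonneg.mpr this
  have hdP : ∀ i j, μ i j * d i j =
      μ i j - μ i j * ∑ a, wip (fun k l => s k * s l) (P i a) (X j (p i j a)) := by
    intro i j
    rcases (hμ0 i j).eq_or_lt with h | h
    · simp [← h]
    · rw [sum_wip_comp (p i j), hd, ← coarsen_coarsen (hrep i j h)]
      ring
  have hdε : ∑ i, ∑ j, μ i j * d i j ≤ ε := by
    simp only [hdP, Finset.sum_sub_distrib, hμ1]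
    linarith
  have hε : 0 ≤ ε := le_trans (Finset.sum_nonneg fun i _ => Finset.sum_nonneg fun j _ =>
    mul_nonneg (hμ0 i j) (hd0 i j)) hdε
  have hεL : ε ≤ L * ε := le_mul_of_one_le_left hε hL1
  set η : I → ℝ := fun i => 1 - ∑ a, wip (fun k l => s k * s l) (E i a) (E i a) with hη
  have hCd : ∀ i j, 1 - ∑ b, wip (fun k l => s k * s l) (C i j b) (C i j b) ≤ 2 * d i j := by
    intro i j
    have := (hC i j).deficit_left_le (hX j) hs0
    rwa [hs1] at this
  have hηi : ∀ i, ∑ j, μ i j * η i ≤ ∑ j, 2 * L * (μ i j * d i j) := by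
    intro i
    have h1 := (hE i).deficit_le_sum_coarsen (s := s) (Finset.univ.filter fun j => 0 < μ i j)
      (p i) (by
        intro a a' hne
        by_contra! hcon
        obtain ⟨ha, ha', hj⟩ := hcon
        obtain ⟨a₀, rfl⟩ := hEne i a ha
        obtain ⟨a₁, rfl⟩ := hEne i a' ha'
        refine hne (hrep' i _ _ fun j hj0 => ?_)
        have := hj j (by simpa using hj0)
        rwa [hrep i j hj0, hrep i j hj0] at this)
    rw [hs1] at h1
    have h2 := h1.trans (Finset.sum_le_sum fun j _ => hCd i j)
    rw [← Finset.sum_mul]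
    refine (mul_le_mul_of_nonneg_left h2 (Finset.sum_nonneg fun j _ => hμ0 i j)).trans ?_
    rw [Finset.mul_sum, Finset.sum_filter]
    refine Finset.sum_le_sum fun j _ => ?_
    split_ifs with hj
    · have := mul_le_mul_of_nonneg_right (hL i j hj) (hd0 i j)
      linarith
    · exact mul_nonneg (by linarith) (mul_nonneg (hμ0 i j) (hd0 i j))
  have hηsum : ∑ i, ∑ j, μ i j * η i ≤ 2 * (L * ε) := by
    refine (Finset.sum_le_sum fun i _ => hηi i).trans ?_
    simp only [← Finset.mul_sum]
    have := mul_le_mul_of_nonneg_left hdε (show 0 ≤ 2 * L by linarith)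
    linarith
  refine ⟨hε, exists_projective_strategy μ hμ0 hμ1 p hE hX s hs hs1 _
    (le_add_sqrt_of_forall_pos (mul_nonneg (by linarith) hε) fun c hc => ?_)⟩
  have hc' : 0 ≤ c⁻¹ := (inv_pos.mpr hc).le
  have hA : ∑ i, ∑ j, μ i j * (1 - ∑ a, wip (fun k l => min (s k ^ 2) (s l ^ 2)) (E i a) (E i a))
      ≤ ∑ i, ∑ j, (μ i j * η i + c⁻¹ * (μ i j * η i) + c / 2 * μ i j) := by
    refine Finset.sum_le_sum fun i _ => Finset.sum_le_sum fun j _ => ?_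
    have h := (hE i).deficit_min_le (hE i) hs0 hc
    rw [hs1] at h
    refine (mul_le_mul_of_nonneg_left h (hμ0 i j)).trans (le_of_eq ?_)
    simp only [hη]
    ring
  have hB : ∑ i, ∑ j, μ i j *
      (1 - ∑ a, wip (fun k l => min (s k ^ 2) (s l ^ 2)) (E i a) (X j (p i j a)))
      ≤ ∑ i, ∑ j, (μ i j * d i j + 2 * c⁻¹ * (μ i j * d i j) + c / 2 * μ i j) := by
    refine Finset.sum_le_sum fun i _ => Finset.sum_le_sum fun j _ => ?_
    rw [sum_wip_comp (p i j)]
    have h := (hC i j).deficit_min_le (hX j) hs0 hc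
    rw [hs1] at h
    have h2 := mul_le_mul_of_nonneg_left (hCd i j) hc'
    have h3 : 1 - ∑ b, wip (fun k l => min (s k ^ 2) (s l ^ 2)) (C i j b) (X j b) ≤
        d i j + 2 * c⁻¹ * d i j + c / 2 := by
      simp only [hd] at h2 ⊢
      linarith
    exact (mul_le_mul_of_nonneg_left h3 (hμ0 i j)).trans (le_of_eq (by ring))
  simp only [Finset.sum_add_distrib, ← Finset.mul_sum, mul_sub, Finset.sum_sub_distrib, mul_one,
    hμ1] at hA hB
  have h1 := mul_le_mul_of_nonneg_left hηsum hc'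
  have h2 := mul_le_mul_of_nonneg_left (hdε.trans hεL) hc'
  have h3 := hdε.trans hεL
  linarith

lemma trace_mul_ofReal_re {n : Type*} [Fintype n] {X Y : Matrix n n ℂ} (hX : X.IsHermitian)
    (hY : Y.IsHermitian) : (((X * Y).trace.re : ℝ) : ℂ) = (X * Y).trace := by
  refine Complex.conj_eq_iff_re.mp ?_
  rw [starRingEnd_apply, ← trace_conjTranspose, conjTranspose_mul, hX.eq, hY.eq, trace_mul_comm]

/-- Every bipartite quantum correlation has a diagonal form on the support of the Schmidt
decomposition of its state. -/
lemma exists_diagonal_form {I J : Type*} {m n : Type} [Fintype m] [DecidableEq m] [Fintype n]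
    [DecidableEq n] {A : I → Type*} [∀ i, Fintype (A i)] {B : J → Type*} [∀ j, Fintype (B j)]
    {P : ∀ i, A i → Matrix m m ℂ} {Q : ∀ j, B j → Matrix n n ℂ}
    (hP : ∀ i, IsPOVM (P i)) (hQ : ∀ j, IsPOVM (Q j))
    (ψ : m × n → ℂ) (hψ : star ψ ⬝ᵥ ψ = 1) :
    ∃ (R : Type) (_ : Fintype R) (_ : DecidableEq R) (s : R → ℝ)
      (E : ∀ i, A i → Matrix R R ℂ) (X : ∀ j, B j → Matrix R R ℂ),
      (∀ k, 0 < s k) ∧ ∑ k, s k ^ 2 = 1 ∧ (∀ i, IsPOVM (E i)) ∧ (∀ j, IsPOVM (X j)) ∧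
      ∀ i j a b, (star ψ ⬝ᵥ ((P i a ⊗ₖ Q j b) *ᵥ ψ)).re =
        wip (fun k l => s k * s l) (E i a) (X j b) := by
  obtain ⟨K, rfl⟩ : ∃ K : Matrix n m ℂ, ψ = vec K := ⟨of fun y x => ψ (x, y), rfl⟩
  obtain ⟨q, _, U, V, s, hs, hU, hV, hK⟩ := exists_reduced_svd K
  set D := diagonal fun i => (s i : ℂ) with hD
  have hDh : Dᴴ = D := by
    rw [hD, diagonal_conjTranspose]
    congr 1
    funext i
    exact Complex.conj_ofReal _
  have hKh : Kᴴ = V * D * Uᴴ := by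
    rw [hK, conjTranspose_mul, conjTranspose_mul, conjTranspose_conjTranspose, hDh,
      Matrix.mul_assoc]
  refine ⟨_, inferInstance, inferInstance, s, fun i a => Vᴴ * (P i a)ᵀ * V,
    fun j b => Uᴴ * Q j b * U, hs, ?_, fun i => ⟨fun a => ?_, ?_⟩, fun j => ⟨fun b => ?_, ?_⟩, ?_⟩
  · have h : (Kᴴ * K).trace = (D * D).trace := by
      rw [hKh]
      conv_lhs => rw [hK]
      calc (V * D * Uᴴ * (U * D * Vᴴ)).trace = (V * (D * (Uᴴ * U) * D * Vᴴ)).trace := by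
            simp only [Matrix.mul_assoc]
        _ = (D * D * (Vᴴ * V)).trace := by
            rw [trace_mul_comm, hU, Matrix.mul_one, Matrix.mul_assoc]
        _ = (D * D).trace := by rw [hV, Matrix.mul_one]
    rw [star_vec_dotProduct_vec, h, hD, diagonal_mul_diagonal, trace_diagonal] at hψ
    simp only [sq]
    exact_mod_cast hψ
  · exact (hP i).1 a |>.transpose.conjTranspose_mul_mul_same V
  · dsimp only
    rw [← Matrix.sum_mul, ← Matrix.mul_sum, ← transpose_sum, (hP i).2, transpose_one,
      Matrix.mul_one, hV]
  · exact (hQ j).1 b |>.conjTranspose_mul_mul_same U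
  · dsimp only
    rw [← Matrix.sum_mul, ← Matrix.mul_sum, (hQ j).2, Matrix.mul_one, hU]
  · intro i j a b
    rw [kronecker_mulVec_vec, star_vec_dotProduct_vec, wip_mul_eq_trace, hKh]
    conv_lhs => rw [hK]
    congr 1
    calc (V * D * Uᴴ * (Q j b * (U * D * Vᴴ) * (P i a)ᵀ)).trace
        = (V * (D * (Uᴴ * Q j b * U) * (D * Vᴴ * (P i a)ᵀ))).trace := by
          simp only [Matrix.mul_assoc]
      _ = ((D * (Uᴴ * Q j b * U)) * (D * (Vᴴ * (P i a)ᵀ * V))).trace := by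
          rw [trace_mul_comm]
          simp only [Matrix.mul_assoc]
      _ = (D * (Vᴴ * (P i a)ᵀ * V) * D * (Uᴴ * Q j b * U)).trace := by
          rw [trace_mul_comm]
          simp only [Matrix.mul_assoc]

end Reduction

/-- Let `G` be an arbitrary (possibly degenerate) projection game and `c` a quantum
correlation with `w_G(c) ≥ 1 - ε`.  With `L = max_{(i,j) : μ(i,j)>0} μ(i)/μ(i,j)`, there
is a finite-dimensional tracial correlation `c'` (PVMs of projections in `Mₙ(ℂ)` and a
density matrix tracial on the generated unital *-subalgebra) with
`w_G(c') ≥ 1 - 148 (L ε)^{1/4}`. -/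
theorem almost_perfect_quantum_strategy_near_tracial_degenerate
    {I J : Type} [Fintype I] [Fintype J] [Nonempty I] [Nonempty J]
    {A : I → Type} [∀ i, Fintype (A i)] [∀ i, Nonempty (A i)]
    {B : J → Type} [∀ j, Fintype (B j)] [∀ j, Nonempty (B j)]
    (μ : I → J → ℝ) (hμ0 : ∀ i j, 0 ≤ μ i j) (hμ1 : ∑ i, ∑ j, μ i j = 1)
    (p : ∀ i j, A i → B j)
    -- `L` is the maximum of `μ(i)/μ(i,j)` over pairs with `μ(i,j) > 0`
    (L : ℝ)
    (hL : IsGreatest {x : ℝ | ∃ i j, 0 < μ i j ∧ x = (∑ j', μ i j') / μ i j} L)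
    -- `c` is a quantum correlation
    {dA dB : ℕ}
    (P : ∀ i, A i → Matrix (Fin dA) (Fin dA) ℂ)
    (Q : ∀ j, B j → Matrix (Fin dB) (Fin dB) ℂ)
    (hP : ∀ i a, (P i a).PosSemidef) (hPsum : ∀ i, ∑ a, P i a = 1)
    (hQ : ∀ j b, (Q j b).PosSemidef) (hQsum : ∀ j, ∑ b, Q j b = 1)
    (ψ : Fin dA × Fin dB → ℂ) (hψ : star ψ ⬝ᵥ ψ = 1)
    (c : ∀ i j, A i → B j → ℝ)
    (hc : ∀ i j a b, (c i j a b : ℂ) = star ψ ⬝ᵥ ((P i a ⊗ₖ Q j b) *ᵥ ψ))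
    -- the strategy wins with probability at least `1 - ε`
    (ε : ℝ)
    (hw : 1 - ε ≤ ∑ i, ∑ j, μ i j * ∑ a, c i j a (p i j a)) :
    ∃ (n : ℕ) (r : ∀ i, A i → Matrix (Fin n) (Fin n) ℂ)
      (s : ∀ j, B j → Matrix (Fin n) (Fin n) ℂ) (σ : Matrix (Fin n) (Fin n) ℂ)
      (c' : ∀ i j, A i → B j → ℝ),
      1 ≤ n ∧
      (∀ i a, (r i a).IsHermitian ∧ r i a * r i a = r i a) ∧ (∀ i, ∑ a, r i a = 1) ∧
      (∀ j b, (s j b).IsHermitian ∧ s j b * s j b = s j b) ∧ (∀ j, ∑ b, s j b = 1) ∧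
      σ.PosSemidef ∧ σ.trace = 1 ∧
      (∀ x y : Matrix (Fin n) (Fin n) ℂ,
        x ∈ StarAlgebra.adjoin ℂ
          ({M | ∃ i a, M = r i a} ∪ {M | ∃ j b, M = s j b}) →
        y ∈ StarAlgebra.adjoin ℂ
          ({M | ∃ i a, M = r i a} ∪ {M | ∃ j b, M = s j b}) →
        (σ * (x * y)).trace = (σ * (y * x)).trace) ∧
      (∀ i j a b, (c' i j a b : ℂ) = (σ * (r i a * s j b)).trace) ∧
      1 - 148 * (L * ε) ^ ((1 : ℝ)/4)
        ≤ ∑ i, ∑ j, μ i j * ∑ a, c' i j a (p i j a) := by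
    classical
  have hμL : ∀ i j, 0 < μ i j → ∑ j', μ i j' ≤ L * μ i j := fun i j h =>
    (div_le_iff₀ h).mp (hL.2 ⟨i, j, h, rfl⟩)
  have hL1 : 1 ≤ L := by
    obtain ⟨i, j, h, rfl⟩ := hL.1
    rw [one_le_div h]
    exact Finset.single_le_sum (fun j _ => hμ0 i j) (Finset.mem_univ j)
  obtain ⟨R, _, _, s, E, X, hs, hs1, hE, hX, hval⟩ := exists_diagonal_form
    (fun i => ⟨hP i, hPsum i⟩) (fun j => ⟨hQ j, hQsum j⟩) ψ hψ
  have hcval : ∀ i j a b, c i j a b = wip (fun k l => s k * s l) (E i a) (X j b) := by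
    intro i j a b
    rw [← hval, ← hc, Complex.ofReal_re]
  simp only [hcval] at hw
  obtain ⟨hε, n, r, t, hn, hr, hr1, ht, ht1, hrt⟩ :=
    exists_projective_strategy_of_value μ hμ0 hμ1 p hL1 hμL hE hX s hs hs1 ε hw
  have hn0 : (0 : ℝ) < n := by exact_mod_cast hn
  have hnC : (n : ℂ) ≠ 0 := by exact_mod_cast hn0.ne'
  refine ⟨n, r, t, (n : ℂ)⁻¹ • 1, fun i j a b => (n : ℝ)⁻¹ * (r i a * t j b).trace.re, hn, hr,
    hr1, ht, ht1, ?_, ?_, ?_, ?_, ?_⟩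
  · exact Matrix.PosSemidef.one.smul (by positivity)
  · simp [hnC]
  · intro x y _ _
    rw [Matrix.smul_mul, Matrix.smul_mul, Matrix.one_mul, Matrix.one_mul, Matrix.trace_smul,
      Matrix.trace_smul, Matrix.trace_mul_comm]
  · intro i j a b
    rw [Matrix.smul_mul, Matrix.one_mul, Matrix.trace_smul, Complex.ofReal_mul,
      trace_mul_ofReal_re (hr i a).1 (ht j b).1]
    simp
  · have hsum : ∑ i, ∑ j, μ i j * ∑ a, (n : ℝ)⁻¹ * (r i a * t j (p i j a)).trace.re =
        (∑ i, ∑ j, μ i j * ∑ a, (r i a * t j (p i j a)).trace.re) / n := by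
      simp only [← Finset.mul_sum, mul_left_comm _ (n : ℝ)⁻¹]
      rw [div_eq_inv_mul]
    have he : 0 ≤ L * ε := mul_nonneg (by linarith) hε
    rw [hsum, le_div_iff₀ hn0]
    rcases le_total (L * ε) 1 with h1 | h1
    · refine le_trans (mul_le_mul_of_nonneg_right ?_ hn0.le) hrt
      have h2 : L * ε ≤ (L * ε) ^ ((1 : ℝ) / 4) :=
        Real.self_le_rpow_of_le_one he h1 (by norm_num)
      have h3 : √(L * ε) ≤ (L * ε) ^ ((1 : ℝ) / 4) := by
        rw [Real.sqrt_eq_rpow]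
        rcases he.eq_or_lt with h0 | h0
        · rw [← h0, Real.zero_rpow (by norm_num), Real.zero_rpow (by norm_num)]
        · exact Real.rpow_le_rpow_of_exponent_ge h0 h1 (by norm_num)
      linarith
    · have h2 : 1 ≤ (L * ε) ^ ((1 : ℝ) / 4) := Real.one_le_rpow h1 (by norm_num)
      refine le_trans (mul_nonpos_of_nonpos_of_nonneg (by linarith) hn0.le) ?_
      exact Finset.sum_nonneg fun i _ => Finset.sum_nonneg fun j _ => mul_nonneg (hμ0 i j)
        (Finset.sum_nonneg fun a _ => trace_mul_re_nonneg
          ((isPOVM_of_projections (hr i) (hr1 i)).1 a)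
          ((isPOVM_of_projections (ht j) (ht1 j)).1 _))
end
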